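/- For every integral polytope P in ℝ^d there exists a positive integer c such that the dilated polytope c·P admits a unimodular triangulation. -/

import Mathlib

open Pointwise

/-- A point of `ℝ^d` with integer coordinates. -/
def IsLatticePt {d : ℕ} (x : Fin d → ℝ) : Prop := ∀ i, ∃ z : ℤ, x i = (z : ℝ)

/-- The subgroup `ℤ^d` of integral points of `ℝ^d`. -/
def intLattice (d : ℕ) : AddSubgroup (Fin d → ℝ) where
  carrier := {x | IsLatticePt x}
  zero_mem' := fun i => ⟨0, by simp⟩
  add_mem' := by
    rintro a b ha hb i
    obtain ⟨z, hz⟩ := ha i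
    obtain ⟨w, hw⟩ := hb i
    exact ⟨z + w, by simp [hz, hw]⟩
  neg_mem' := by
    rintro a ha i
    obtain ⟨z, hz⟩ := ha i
    exact ⟨-z, by simp [hz]⟩

/-- A polytope: the convex hull of a nonempty finite set of points. -/
def IsPolytope {d : ℕ} (P : Set (Fin d → ℝ)) : Prop :=
  ∃ V : Finset (Fin d → ℝ), V.Nonempty ∧ P = convexHull ℝ (V : Set (Fin d → ℝ))

/-- An integral polytope: the convex hull of a nonempty finite set of integral points. -/
def IsIntegralPolytope {d : ℕ} (P : Set (Fin d → ℝ)) : Prop :=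
  ∃ V : Finset (Fin d → ℝ), V.Nonempty ∧ (∀ v ∈ V, IsLatticePt v) ∧
    P = convexHull ℝ (V : Set (Fin d → ℝ))

/-- A simplex: the convex hull of a nonempty affinely independent finite set. -/
def IsSimplex {d : ℕ} (P : Set (Fin d → ℝ)) : Prop :=
  ∃ V : Finset (Fin d → ℝ), V.Nonempty ∧
    AffineIndependent ℝ (Subtype.val : ↥(V : Set (Fin d → ℝ)) → (Fin d → ℝ)) ∧
    P = convexHull ℝ (V : Set (Fin d → ℝ))

/-- An integral simplex. -/
def IsIntegralSimplex {d : ℕ} (P : Set (Fin d → ℝ)) : Prop :=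
  ∃ V : Finset (Fin d → ℝ), V.Nonempty ∧ (∀ v ∈ V, IsLatticePt v) ∧
    AffineIndependent ℝ (Subtype.val : ↥(V : Set (Fin d → ℝ)) → (Fin d → ℝ)) ∧
    P = convexHull ℝ (V : Set (Fin d → ℝ))

/-- The set of differences of vertices (= extreme points) of a polytope. -/
def vertexDiffs {d : ℕ} (P : Set (Fin d → ℝ)) : Set (Fin d → ℝ) :=
  {w | ∃ u ∈ P.extremePoints ℝ, ∃ v ∈ P.extremePoints ℝ, w = u - v}

/-- `L(P)`: the subgroup of `ℤ^d` generated by differences of vertices of `P`. -/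
def latL {d : ℕ} (P : Set (Fin d → ℝ)) : AddSubgroup (Fin d → ℝ) :=
  AddSubgroup.closure (vertexDiffs P)

/-- `N(P)`: the intersection of the real span of `L(P)` with `ℤ^d`. -/
def latN {d : ℕ} (P : Set (Fin d → ℝ)) : AddSubgroup (Fin d → ℝ) :=
  (Submodule.span ℝ (vertexDiffs P)).toAddSubgroup ⊓ intLattice d

/-- The (normalized) index of an integral polytope: the group index `[N(P) : L(P)]`. -/
noncomputable def polyIndex {d : ℕ} (P : Set (Fin d → ℝ)) : ℕ :=
  ((latL P).addSubgroupOf (latN P)).index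

/-- A unimodular simplex: an integral simplex of index 1. -/
def IsUnimodularSimplex {d : ℕ} (P : Set (Fin d → ℝ)) : Prop :=
  IsIntegralSimplex P ∧ polyIndex P = 1

/-- `F` is a face of `P`: the (nonempty) set of maximizers on `P` of a linear functional. -/
def IsFaceOf {d : ℕ} (F P : Set (Fin d → ℝ)) : Prop :=
  F.Nonempty ∧ ∃ φ : (Fin d → ℝ) →ₗ[ℝ] ℝ, F = {x ∈ P | ∀ y ∈ P, φ y ≤ φ x}

/-- A triangulation of `Q`: a finite, face-closed collection of simplices with union `Q`,
any two of which meet in a (possibly empty) common face. -/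
def IsTriangulation {d : ℕ} (T : Set (Set (Fin d → ℝ))) (Q : Set (Fin d → ℝ)) : Prop :=
  T.Finite ∧ (∀ S ∈ T, IsSimplex S) ∧ ⋃₀ T = Q ∧
    (∀ S ∈ T, ∀ F, IsFaceOf F S → F ∈ T) ∧
    ∀ S₁ ∈ T, ∀ S₂ ∈ T, S₁ ∩ S₂ = ∅ ∨ (IsFaceOf (S₁ ∩ S₂) S₁ ∧ IsFaceOf (S₁ ∩ S₂) S₂)

/-- A unimodular triangulation: all of its simplices are unimodular. -/
def IsUnimodularTriangulation {d : ℕ} (T : Set (Set (Fin d → ℝ))) (Q : Set (Fin d → ℝ)) : Prop :=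
  IsTriangulation T Q ∧ ∀ S ∈ T, IsUnimodularSimplex S

set_option linter.unusedSectionVars false

namespace EdgewiseFan

open Finset Filter Topology

section Basic

variable {M : Type*} [AddCommGroup M] [Module ℝ M]

/-- The vector `∑ v, x v • v` with coefficients `x`. -/
noncomputable abbrev bary : (M →₀ ℝ) →ₗ[ℝ] M := Finsupp.linearCombination ℝ id

/-- The cone generated by a finite set of vectors. -/
def coneOf (t : Finset M) : Set M := {x | ∃ y : M →₀ ℝ, 0 ≤ y ∧ y.support ⊆ t ∧ bary y = x}

/-- The nonnegative coefficient vectors supported on some member of `K`. -/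
def coeffs (K : Set (Finset M)) : Set (M →₀ ℝ) := {y | 0 ≤ y ∧ y.support ∈ K}

/-- The union of the cones generated by the members of `K`. -/
def carrier (K : Set (Finset M)) : Set M := bary '' coeffs K

/-- A simplicial fan: a family of finite sets of vectors, closed under subsets, such that every
vector has at most one representation as a positive combination of a member of the family. -/
structure IsFan (K : Set (Finset M)) : Prop where
  down : ∀ s ∈ K, ∀ t ⊆ s, t ∈ K
  inj : Set.InjOn bary (coeffs K)

theorem mem_span_iff {s : Finset M} {x : M} :
    x ∈ Submodule.span ℝ (s : Set M) ↔ ∃ y : M →₀ ℝ, y.support ⊆ s ∧ bary y = x := by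
  rw [Submodule.mem_span_set]
  simp [Finsupp.linearCombination_apply]

theorem bary_eq_sum {s : Finset M} {y : M →₀ ℝ} (h : y.support ⊆ s) :
    bary y = ∑ v ∈ s, y v • v := by
  rw [Finsupp.linearCombination_apply, Finsupp.sum_of_support_subset _ h _ (by simp)]
  rfl

theorem mem_closure_iff {s : Finset M} {x : M} :
    x ∈ AddSubgroup.closure (s : Set M) ↔
      ∃ y : M →₀ ℝ, y.support ⊆ s ∧ (∀ v, ∃ n : ℤ, y v = n) ∧ bary y = x := by
  classical
  constructor
  · intro h
    induction h using AddSubgroup.closure_induction with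
    | mem x hx =>
      refine ⟨Finsupp.single x 1, (Finsupp.support_single_subset).trans (by simpa using hx),
        fun v => ?_, by simp⟩
      by_cases h : x = v
      · exact ⟨1, by simp [h]⟩
      · exact ⟨0, by simp [h]⟩
    | zero => exact ⟨0, by simp, fun v => ⟨0, by simp⟩, by simp⟩
    | add a b _ _ ha hb =>
      obtain ⟨y, hy, hy', rfl⟩ := ha
      obtain ⟨z, hz, hz', rfl⟩ := hb
      refine ⟨y + z, Finsupp.support_add.trans (union_subset hy hz), fun v => ?_, by simp⟩
      obtain ⟨n, hn⟩ := hy' v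
      obtain ⟨m, hm⟩ := hz' v
      exact ⟨n + m, by simp [hn, hm]⟩
    | neg a _ ha =>
      obtain ⟨y, hy, hy', rfl⟩ := ha
      refine ⟨-y, by simpa using hy, fun v => ?_, by simp⟩
      obtain ⟨n, hn⟩ := hy' v
      exact ⟨-n, by simp [hn]⟩
  · rintro ⟨y, hy, hy', rfl⟩
    rw [bary_eq_sum hy]
    refine sum_mem fun v hv => ?_
    obtain ⟨n, hn⟩ := hy' v
    rw [hn, Int.cast_smul_eq_zsmul]
    exact zsmul_mem (AddSubgroup.subset_closure hv) n

theorem IsFan.ext_of_subset {K : Set (Finset M)} (hK : IsFan K) {s : Finset M} (hs : s ∈ K)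
    {x y : M →₀ ℝ} (hx : x.support ⊆ s) (hy : y.support ⊆ s) (h : bary x = bary y) : x = y := by
  classical
  set u := x - y with hu
  have hus : u.support ⊆ s := Finsupp.support_sub.trans (union_subset hx hy)
  let a : M →₀ ℝ := u.mapRange (fun r => max r 0) (by simp)
  let b : M →₀ ℝ := u.mapRange (fun r => max (-r) 0) (by simp)
  have hab : a - b = u := by
    ext v
    simp only [a, b, Finsupp.coe_sub, Pi.sub_apply, Finsupp.mapRange_apply]
    rcases le_total (u v) 0 with h | h
    · rw [max_eq_right h, max_eq_left (by linarith)]; ring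
    · rw [max_eq_left h, max_eq_right (by linarith)]; ring
  have ha : a ∈ coeffs K := ⟨fun v => by simp [a], hK.down s hs _
    (Finsupp.support_mapRange.trans hus)⟩
  have hb : b ∈ coeffs K := ⟨fun v => by simp [b], hK.down s hs _
    (Finsupp.support_mapRange.trans hus)⟩
  have hbar : bary a = bary b := by
    rw [← sub_eq_zero, ← map_sub, hab, hu, map_sub, h, sub_self]
  have := hK.inj ha hb hbar
  rw [this, sub_self] at hab
  exact sub_eq_zero.1 hab.symm

theorem carrier_eq_iUnion {K : Set (Finset M)} (hK : ∀ s ∈ K, ∀ t ⊆ s, t ∈ K) :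
    carrier K = ⋃ t ∈ K, coneOf t := by
  ext x
  simp only [carrier, coeffs, coneOf, Set.mem_image, Set.mem_ofPred_eq, Set.mem_iUnion]
  constructor
  · rintro ⟨y, ⟨h0, hy⟩, rfl⟩
    exact ⟨_, hy, y, h0, subset_rfl, rfl⟩
  · rintro ⟨t, ht, y, h0, hy, rfl⟩
    exact ⟨y, ⟨h0, hK t ht _ hy⟩, rfl⟩

theorem coneOf_mono {s t : Finset M} (h : s ⊆ t) : coneOf s ⊆ coneOf t := by
  rintro _ ⟨y, h0, hy, rfl⟩
  exact ⟨y, h0, hy.trans h, rfl⟩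

theorem add_mem_coneOf {t : Finset M} {x y : M} (hx : x ∈ coneOf t) (hy : y ∈ coneOf t) :
    x + y ∈ coneOf t := by
  classical
  obtain ⟨a, h0, ha, rfl⟩ := hx
  obtain ⟨b, h0', hb, rfl⟩ := hy
  exact ⟨a + b, add_nonneg h0 h0', Finsupp.support_add.trans (union_subset ha hb), by simp⟩

theorem zero_mem_coneOf {t : Finset M} : (0 : M) ∈ coneOf t := ⟨0, le_rfl, by simp, by simp⟩

theorem smul_mem_coneOf {t : Finset M} {x : M} {r : ℝ} (hr : 0 ≤ r) (hx : x ∈ coneOf t) :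
    r • x ∈ coneOf t := by
  obtain ⟨a, h0, ha, rfl⟩ := hx
  exact ⟨r • a, smul_nonneg hr h0, Finsupp.support_smul.trans ha, by simp⟩

theorem sum_mem_coneOf {ι : Type*} {t : Finset M} {s : Finset ι} {f : ι → M}
    (h : ∀ i ∈ s, f i ∈ coneOf t) : ∑ i ∈ s, f i ∈ coneOf t := by
  classical
  induction s using Finset.induction_on with
  | empty => simpa using zero_mem_coneOf
  | insert a s ha ih =>
    rw [sum_insert ha]
    exact add_mem_coneOf (h _ (mem_insert_self _ _)) (ih fun i hi => h i (mem_insert_of_mem hi))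

theorem mem_coneOf_of_mem {t : Finset M} {v : M} (h : v ∈ t) : v ∈ coneOf t :=
  ⟨Finsupp.single v 1, by simp, Finsupp.support_single_subset.trans (by simpa using h), by simp⟩

theorem coneOf_trans {s t : Finset M} (h : ∀ p ∈ s, p ∈ coneOf t) : coneOf s ⊆ coneOf t := by
  rintro _ ⟨y, h0, hy, rfl⟩
  rw [bary_eq_sum hy]
  exact sum_mem_coneOf fun v hv => smul_mem_coneOf (h0 v) (h v hv)

theorem coneOf_subset_span {t : Finset M} : coneOf t ⊆ Submodule.span ℝ (t : Set M) := by
  rintro _ ⟨y, _, hy, rfl⟩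
  exact mem_span_iff.2 ⟨y, hy, rfl⟩

/-- In a fan, the cone of a member `g` meets the cone of a member `t` in a face. -/
theorem IsFan.mem_coneOf_of_add {K : Set (Finset M)} (hK : IsFan K) {t g : Finset M} (ht : t ∈ K)
    (hg : g ∈ K) {u w : M} (hu : u ∈ coneOf t) (hw : w ∈ coneOf t) (h : u + w ∈ coneOf g) :
    u ∈ coneOf g := by
  classical
  obtain ⟨a, h0, ha, rfl⟩ := hu
  obtain ⟨b, h0', hb, rfl⟩ := hw
  obtain ⟨e, h0'', he, h⟩ := h
  have : e = a + b := hK.inj ⟨h0'', hK.down g hg _ he⟩ ⟨add_nonneg h0 h0', hK.down t ht _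
    (Finsupp.support_add.trans (union_subset ha hb))⟩ (by simpa using h)
  refine ⟨a, h0, fun v hv => he ?_, rfl⟩
  subst this
  have h1 := lt_of_le_of_ne (h0 v) (Ne.symm (Finsupp.mem_support_iff.1 hv))
  have h2 := h0' v
  simp only [Finsupp.coe_zero, Pi.zero_apply] at h1 h2
  simp only [Finsupp.mem_support_iff, Finsupp.coe_add, Pi.add_apply]
  linarith

theorem IsFan.mem_coneOf_of_sum {ι : Type*} {K : Set (Finset M)} (hK : IsFan K) {t g : Finset M}
    (ht : t ∈ K) (hg : g ∈ K) {s : Finset ι} {f : ι → M} (hf : ∀ i ∈ s, f i ∈ coneOf t)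
    (h : ∑ i ∈ s, f i ∈ coneOf g) : ∀ i ∈ s, f i ∈ coneOf g := by
  classical
  intro i hi
  rw [← add_sum_erase _ _ hi] at h
  exact hK.mem_coneOf_of_add ht hg (hf i hi)
    (sum_mem_coneOf fun j hj => hf j (mem_of_mem_erase hj)) h

theorem IsFan.support_subset_of_mem_coneOf {K : Set (Finset M)} (hK : IsFan K) {g : Finset M}
    (hg : g ∈ K) {x : M →₀ ℝ} (hx : x ∈ coeffs K) (h : bary x ∈ coneOf g) : x.support ⊆ g := by
  obtain ⟨y, h0, hy, h⟩ := h
  have : y = x := hK.inj ⟨h0, hK.down g hg _ hy⟩ hx h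
  exact this ▸ hy

theorem IsFan.mem_of_mem_coneOf {K : Set (Finset M)} (hK : IsFan K) {g t : Finset M}
    (hg : g ∈ K) (ht : t ∈ K) {v : M} (hv : v ∈ t) (h : v ∈ coneOf g) : v ∈ g := by
  have := hK.support_subset_of_mem_coneOf hg (x := Finsupp.single v 1)
    ⟨by simp, hK.down t ht _ (Finsupp.support_single_subset.trans (by simpa using hv))⟩ (by simpa)
  exact this (by simp)

end Basic

section Edgewise

variable {M : Type*} [AddCommGroup M] [LinearOrder M]

/-- `A` is a face of the edgewise subdivision of the `c`-th dilation of the simplex with ordered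
vertex set `t`: its members are the sums of pairwise interleaving monotone sequences of length `c`
of elements of `t`. -/
def EdgewiseFace (c : ℕ) (t A : Finset M) : Prop :=
  ∃ V : M → ℕ → M, (∀ p ∈ A, ∑ l ∈ range c, V p l = p) ∧ (∀ p ∈ A, ∀ l < c, V p l ∈ t) ∧
    (∀ p ∈ A, ∀ q ∈ A, ∀ l l', l < l' → l' < c → V p l ≤ V q l') ∧
    ∀ p ∈ A, ∀ q ∈ A, p ≤ q → ∀ l < c, V p l ≤ V q l

/-- The edgewise subdivision of a family of simplices. -/
def edgewise (c : ℕ) (K : Set (Finset M)) : Set (Finset M) := {A | ∃ t ∈ K, EdgewiseFace c t A}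

theorem EdgewiseFace.subset {c : ℕ} {t A B : Finset M} (h : EdgewiseFace c t A) (hB : B ⊆ A) :
    EdgewiseFace c t B := by
  obtain ⟨V, h1, h2, h3, h4⟩ := h
  exact ⟨V, fun p hp => h1 p (hB hp), fun p hp => h2 p (hB hp),
    fun p hp q hq => h3 p (hB hp) q (hB hq), fun p hp q hq => h4 p (hB hp) q (hB hq)⟩

theorem EdgewiseFace.mono {c : ℕ} {t t' A : Finset M} (h : EdgewiseFace c t A) (ht : t ⊆ t') :
    EdgewiseFace c t' A := by
  obtain ⟨V, h1, h2, h3, h4⟩ := h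
  exact ⟨V, h1, fun p hp l hl => ht (h2 p hp l hl), h3, h4⟩

theorem edgewise_mono {c : ℕ} {K K' : Set (Finset M)} (h : K ⊆ K') :
    edgewise c K ⊆ edgewise c K' := fun _ ⟨t, ht, hA⟩ => ⟨t, h ht, hA⟩

theorem edgewiseFace_one (t : Finset M) : EdgewiseFace 1 t t :=
  ⟨fun p _ => p, by simp, by simp, fun _ _ _ _ l l' h h' => by omega, fun _ _ _ _ h _ _ => h⟩

theorem sum_range_mul_add {N : Type*} [AddCommMonoid N] (a c : ℕ) (f : ℕ → N) :
    ∑ x ∈ range (c * a), f x = ∑ l ∈ range c, ∑ k ∈ range a, f (l * a + k) := by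
  induction c with
  | zero => simp
  | succ c ih => rw [sum_range_succ, ← ih, Nat.succ_mul, sum_range_add]

/-- An edgewise subdivision of an edgewise subdivision is an edgewise subdivision. -/
theorem EdgewiseFace.trans {a c : ℕ} {t B A : Finset M} (hA : EdgewiseFace a B A)
    (hB : EdgewiseFace c t B) : EdgewiseFace (c * a) t A := by
  obtain ⟨W, w1, w2, w3, w4⟩ := hA
  obtain ⟨V, v1, v2, v3, v4⟩ := hB
  have key : ∀ x, x < c * a → x % a < a ∧ x / a < c := fun x hx => by
    have ha : 0 < a := by
      rcases Nat.eq_zero_or_pos a with rfl | h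
      · simp at hx
      · exact h
    exact ⟨Nat.mod_lt _ ha, Nat.div_lt_of_lt_mul (by rwa [mul_comm])⟩
  refine ⟨fun p x => V (W p (x % a)) (x / a), fun p hp => ?_, fun p hp x hx => ?_,
    fun p hp q hq x y hxy hy => ?_, fun p hp q hq hpq x hx => ?_⟩
  · rw [sum_range_mul_add, sum_comm]
    conv_rhs => rw [← w1 p hp]
    refine sum_congr rfl fun k hk => ?_
    have hk := mem_range.1 hk
    have ha : 0 < a := by omega
    rw [← v1 _ (w2 p hp k hk)]
    refine sum_congr rfl fun l _ => ?_
    have e1 : (l * a + k) % a = k := by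
      rw [Nat.mul_add_mod_self_right, Nat.mod_eq_of_lt hk]
    have e2 : (l * a + k) / a = l := by
      rw [mul_comm, Nat.mul_add_div ha, Nat.div_eq_of_lt hk, add_zero]
    beta_reduce
    rw [e1, e2]
  · exact v2 _ (w2 p hp _ (key x hx).1) _ (key x hx).2
  · have hx := hxy.trans hy
    rcases lt_or_eq_of_le (Nat.div_le_div_right (c := a) hxy.le) with h | h
    · exact v3 _ (w2 p hp _ (key x hx).1) _ (w2 q hq _ (key y hy).1) _ _ h (key y hy).2
    · have hm : x % a < y % a := by
        have h1 := Nat.div_add_mod x a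
        have h2 := Nat.div_add_mod y a
        rw [← h] at h2
        omega
      simp only [← h]
      exact v4 _ (w2 p hp _ (key x hx).1) _ (w2 q hq _ (key y hy).1)
        (w3 p hp q hq _ _ hm (key y hy).1) _ (key x hx).2
  · exact v4 _ (w2 p hp _ (key x hx).1) _ (w2 q hq _ (key x hx).1)
      (w4 p hp q hq hpq _ (key x hx).1) _ (key x hx).2

theorem EdgewiseFace.mem_coneOf [Module ℝ M] {c : ℕ} {t A : Finset M} (h : EdgewiseFace c t A)
    {p : M} (hp : p ∈ A) : p ∈ coneOf t := by
  obtain ⟨V, h1, h2, -⟩ := h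
  rw [← h1 p hp]
  exact sum_mem_coneOf fun l hl => mem_coneOf_of_mem (h2 p hp l (mem_range.1 hl))

end Edgewise

section Uniqueness

variable {M : Type*} [AddCommGroup M] [LinearOrder M] [Module ℝ M]

/-- The sum of the coefficients. -/
noncomputable abbrev total : (M →₀ ℝ) →ₗ[ℝ] ℝ := Finsupp.linearCombination ℝ (fun _ => 1)

theorem linearCombination_eq_sum {N : Type*} [AddCommGroup N] [Module ℝ N] (f : M → N)
    {s : Finset M} {y : M →₀ ℝ} (h : y.support ⊆ s) :
    Finsupp.linearCombination ℝ f y = ∑ v ∈ s, y v • f v := by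
  rw [Finsupp.linearCombination_apply, Finsupp.sum_of_support_subset _ h _ (by simp)]

/-- The coordinates of the sum of a sequence. -/
noncomputable def seqCoord (c : ℕ) (V : M → ℕ → M) (p : M) : M →₀ ℝ :=
  ∑ l ∈ range c, Finsupp.single (V p l) 1

theorem seqCoord_nonneg (c : ℕ) (V : M → ℕ → M) (p : M) : 0 ≤ seqCoord c V p :=
  sum_nonneg fun _ _ => by simp

theorem support_seqCoord {c : ℕ} {V : M → ℕ → M} {p : M} {t : Finset M}
    (h : ∀ l < c, V p l ∈ t) : (seqCoord c V p).support ⊆ t := by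
  refine Finsupp.support_finsetSum.trans fun v hv => ?_
  rw [Finset.mem_biUnion] at hv
  obtain ⟨l, hl, hv⟩ := hv
  have := Finsupp.support_single_subset hv
  rw [mem_singleton.1 this]
  exact h l (mem_range.1 hl)

theorem bary_seqCoord (c : ℕ) (V : M → ℕ → M) (p : M) :
    bary (seqCoord c V p) = ∑ l ∈ range c, V p l := by
  simp [seqCoord, map_sum]

theorem total_seqCoord (c : ℕ) (V : M → ℕ → M) (p : M) : total (seqCoord c V p) = c := by
  simp [seqCoord, map_sum]

theorem seqCoord_int (c : ℕ) (V : M → ℕ → M) (p v : M) : ∃ n : ℤ, seqCoord c V p v = n := by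
  refine ⟨∑ l ∈ range c, if V p l = v then 1 else 0, ?_⟩
  simp [seqCoord, Finsupp.single_apply]

/-- The comparison step in the uniqueness of edgewise coordinates. -/
theorem interleaved_not_lt {c : ℕ} {z z' : M →₀ ℝ} {V V' : M → ℕ → M}
    (hz : 0 ≤ z) (hz' : 0 ≤ z')
    (h2 : ∀ p ∈ z.support, ∀ q ∈ z.support, ∀ l l', l < l' → l' < c → V p l ≤ V q l')
    (h2' : ∀ p ∈ z'.support, ∀ q ∈ z'.support, ∀ l l', l < l' → l' < c → V' p l ≤ V' q l')
    (h3' : ∀ p ∈ z'.support, ∀ q ∈ z'.support, p ≤ q → ∀ l < c, V' p l ≤ V' q l)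
    (H : ∀ φ : M → ℝ, Finsupp.linearCombination ℝ (fun p => ∑ l ∈ range c, φ (V p l)) z =
      Finsupp.linearCombination ℝ (fun p => ∑ l ∈ range c, φ (V' p l)) z')
    {p p' : M} (hp : p ∈ z.support) (hp' : p' ∈ z'.support) (hmin : ∀ q ∈ z'.support, p' ≤ q)
    {l : ℕ} (hl : l < c) : ¬ V p l < V' p' l := by
  intro hlt
  set u := V p l
  let φ : M → ℝ := fun v => if v ≤ u then 1 else 0
  have hφ0 : ∀ v, 0 ≤ φ v := fun v => by simp only [φ]; split_ifs <;> norm_num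
  have hS : ∑ q ∈ z.support, z q = ∑ q ∈ z'.support, z' q := by
    have := H fun _ => 1
    rw [linearCombination_eq_sum _ subset_rfl, linearCombination_eq_sum _ subset_rfl] at this
    simp only [sum_const, card_range, nsmul_eq_mul, mul_one, smul_eq_mul, ← sum_mul] at this
    exact mul_right_cancel₀ (by exact_mod_cast (by omega : c ≠ 0)) this
  have h1 : ∀ q ∈ z.support, (l : ℝ) ≤ ∑ k ∈ range c, φ (V q k) := fun q hq => by
    calc (l : ℝ) = ∑ k ∈ range l, 1 := by simp
      _ = ∑ k ∈ range l, φ (V q k) := sum_congr rfl fun k hk => by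
          simp only [φ]; rw [if_pos (h2 q hq p hp k l (mem_range.1 hk) hl)]
      _ ≤ _ := sum_le_sum_of_subset_of_nonneg (range_mono hl.le) fun _ _ _ => hφ0 _
  have h1p : (l : ℝ) + 1 ≤ ∑ k ∈ range c, φ (V p k) := by
    calc (l : ℝ) + 1 = ∑ k ∈ range (l + 1), 1 := by simp
      _ = ∑ k ∈ range (l + 1), φ (V p k) := sum_congr rfl fun k hk => by
          have : V p k ≤ u := by
            rcases lt_or_eq_of_le (Nat.lt_succ_iff.1 (mem_range.1 hk)) with h | h
            · exact h2 p hp p hp k l h hl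
            · rw [h]
          simp only [φ]; rw [if_pos this]
      _ ≤ _ := sum_le_sum_of_subset_of_nonneg (range_mono hl) fun _ _ _ => hφ0 _
  have h4 : ∀ q ∈ z'.support, ∑ k ∈ range c, φ (V' q k) ≤ (l : ℝ) := fun q hq => by
    calc ∑ k ∈ range c, φ (V' q k) = ∑ k ∈ range l, φ (V' q k) := by
          symm
          refine sum_subset (range_mono hl.le) fun k hk hk' => ?_
          rw [mem_range] at hk hk'
          have : u < V' q k := by
            rcases lt_or_eq_of_le (not_lt.1 hk') with h | h
            · exact hlt.trans_le (h2' p' hp' q hq l k h hk)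
            · exact hlt.trans_le (h ▸ h3' p' hp' q hq (hmin q hq) l hl)
          simp only [φ]; rw [if_neg (not_le.2 this)]
      _ ≤ ∑ k ∈ range l, 1 := sum_le_sum fun k _ => by
          simp only [φ]; split_ifs <;> norm_num
      _ = l := by simp
  have hH := H φ
  rw [linearCombination_eq_sum _ subset_rfl, linearCombination_eq_sum _ subset_rfl] at hH
  simp only [smul_eq_mul] at hH
  have hpos : 0 < z p := lt_of_le_of_ne (hz p) (Ne.symm (Finsupp.mem_support_iff.1 hp))
  have hL : ∑ q ∈ z.support, z q * l < ∑ q ∈ z.support, z q * ∑ k ∈ range c, φ (V q k) :=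
    sum_lt_sum (fun q hq => mul_le_mul_of_nonneg_left (h1 q hq) (hz q))
      ⟨p, hp, mul_lt_mul_of_pos_left (by linarith) hpos⟩
  have hR : ∑ q ∈ z'.support, z' q * ∑ k ∈ range c, φ (V' q k) ≤ ∑ q ∈ z'.support, z' q * l :=
    sum_le_sum fun q hq => mul_le_mul_of_nonneg_left (h4 q hq) (hz' q)
  rw [← sum_mul] at hL hR
  rw [hS] at hL
  linarith

theorem eq_of_interleaved {c : ℕ} (hc : 0 < c) {V V' : M → ℕ → M} (z z' : M →₀ ℝ)
    (hz : 0 ≤ z) (hz' : 0 ≤ z')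
    (h1 : ∀ p ∈ z.support, ∑ l ∈ range c, V p l = p)
    (h1' : ∀ p ∈ z'.support, ∑ l ∈ range c, V' p l = p)
    (h2 : ∀ p ∈ z.support, ∀ q ∈ z.support, ∀ l l', l < l' → l' < c → V p l ≤ V q l')
    (h2' : ∀ p ∈ z'.support, ∀ q ∈ z'.support, ∀ l l', l < l' → l' < c → V' p l ≤ V' q l')
    (h3 : ∀ p ∈ z.support, ∀ q ∈ z.support, p ≤ q → ∀ l < c, V p l ≤ V q l)
    (h3' : ∀ p ∈ z'.support, ∀ q ∈ z'.support, p ≤ q → ∀ l < c, V' p l ≤ V' q l)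
    (H : ∀ φ : M → ℝ, Finsupp.linearCombination ℝ (fun p => ∑ l ∈ range c, φ (V p l)) z =
      Finsupp.linearCombination ℝ (fun p => ∑ l ∈ range c, φ (V' p l)) z') : z = z' := by
  induction hn : z.support.card + z'.support.card using Nat.strong_induction_on
    generalizing z z' with
  | _ n ih =>
  have hS : ∑ q ∈ z.support, z q = ∑ q ∈ z'.support, z' q := by
    have := H fun _ => 1
    rw [linearCombination_eq_sum _ subset_rfl, linearCombination_eq_sum _ subset_rfl] at this
    simp only [sum_const, card_range, nsmul_eq_mul, mul_one, smul_eq_mul, ← sum_mul] at this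
    exact mul_right_cancel₀ (by exact_mod_cast hc.ne') this
  have hpos : ∀ {y : M →₀ ℝ}, 0 ≤ y → ∀ p ∈ y.support, 0 < y p := fun hy p hp =>
    lt_of_le_of_ne (hy p) (Ne.symm (Finsupp.mem_support_iff.1 hp))
  rcases z.support.eq_empty_or_nonempty with he | he
  · rcases z'.support.eq_empty_or_nonempty with he' | he'
    · rw [Finsupp.support_eq_empty.1 he, Finsupp.support_eq_empty.1 he']
    · have := sum_pos (hpos hz') he'
      rw [← hS, he] at this
      simp at this
  rcases z'.support.eq_empty_or_nonempty with he' | he'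
  · have := sum_pos (hpos hz) he
    rw [hS, he'] at this
    simp at this
  set p := z.support.min' he
  set p' := z'.support.min' he'
  have hp : p ∈ z.support := min'_mem _ _
  have hp' : p' ∈ z'.support := min'_mem _ _
  have hV : ∀ l < c, V p l = V' p' l := fun l hl => le_antisymm
    (not_lt.1 (interleaved_not_lt hz' hz h2' h2 h3 (fun φ => (H φ).symm) hp' hp
      (fun q hq => min'_le _ _ hq) hl))
    (not_lt.1 (interleaved_not_lt hz hz' h2 h2' h3' H hp hp' (fun q hq => min'_le _ _ hq) hl))
  have hpp : p = p' := by
    rw [← h1 p hp, ← h1' p' hp']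
    exact sum_congr rfl fun l hl => hV l (mem_range.1 hl)
  rw [← hpp] at hV hp'
  have key : ∀ {y : M →₀ ℝ} {m : ℝ}, 0 ≤ y → p ∈ y.support → m ≤ y p →
      0 ≤ y - Finsupp.single p m ∧ (y - Finsupp.single p m).support ⊆ y.support ∧
      (m = y p → (y - Finsupp.single p m).support.card < y.support.card) := by
    intro y m hy hpy hm
    have hsub : (y - Finsupp.single p m).support ⊆ y.support := by
      intro q hq
      rw [Finsupp.mem_support_iff] at hq ⊢
      by_cases hqp : q = p
      · rw [hqp]; exact Finsupp.mem_support_iff.1 hpy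
      · simpa [Finsupp.single_apply, Ne.symm hqp] using hq
    refine ⟨fun q => ?_, hsub, fun h => card_lt_card ⟨hsub, fun h' => ?_⟩⟩
    · by_cases hqp : q = p
      · simpa [hqp] using hm
      · simpa [Finsupp.single_apply, Ne.symm hqp] using hy q
    · have := h' hpy
      simp [h] at this
  set m := min (z p) (z' p)
  obtain ⟨k0, ks, kc⟩ := key (m := m) hz hp (min_le_left _ _ : m ≤ z p)
  obtain ⟨k0', ks', kc'⟩ := key (m := m) hz' hp' (min_le_right _ _ : m ≤ z' p)
  have := ih _ ?_ (z - Finsupp.single p m) (z' - Finsupp.single p m) k0 k0'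
    (fun q hq => h1 q (ks hq)) (fun q hq => h1' q (ks' hq))
    (fun q hq r hr => h2 q (ks hq) r (ks hr)) (fun q hq r hr => h2' q (ks' hq) r (ks' hr))
    (fun q hq r hr => h3 q (ks hq) r (ks hr)) (fun q hq r hr => h3' q (ks' hq) r (ks' hr))
    (fun φ => ?_) rfl
  · exact sub_left_injective this
  · have a1 := card_le_card ks
    have a2 := card_le_card ks'
    rcases min_choice (z p) (z' p) with h | h
    · have := kc h; omega
    · have := kc' h; omega
  · rw [map_sub, map_sub, H φ, Finsupp.linearCombination_single, Finsupp.linearCombination_single,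
      sum_congr rfl fun l hl => by rw [hV l (mem_range.1 hl)]]

/-- The edgewise subdivision of a fan is a fan. -/
theorem IsFan.edgewise {K : Set (Finset M)} (hK : IsFan K) {c : ℕ} (hc : 0 < c) :
    IsFan (edgewise c K) := by
  refine ⟨fun s ⟨t, ht, hs⟩ s' hs' => ⟨t, ht, hs.subset hs'⟩, ?_⟩
  rintro z ⟨hz, t, ht, V, h1, h2, h3, h4⟩ z' ⟨hz', t', ht', V', h1', h2', h3', h4'⟩ hzz
  have aux : ∀ {y : M →₀ ℝ} {W : M → ℕ → M} {s : Finset M}, 0 ≤ y →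
      (∀ p ∈ y.support, ∑ l ∈ range c, W p l = p) → (∀ p ∈ y.support, ∀ l < c, W p l ∈ s) →
      s ∈ K → Finsupp.linearCombination ℝ (seqCoord c W) y ∈ coeffs K ∧
      bary (Finsupp.linearCombination ℝ (seqCoord c W) y) = bary y := by
    intro y W s hy w1 w2 hs
    rw [linearCombination_eq_sum _ subset_rfl, bary_eq_sum (subset_refl y.support)]
    refine ⟨⟨sum_nonneg fun p _ => smul_nonneg (hy p) (seqCoord_nonneg _ _ _), hK.down s hs _ ?_⟩,
      ?_⟩
    · refine Finsupp.support_finsetSum.trans (Finset.biUnion_subset.2 fun p hp => ?_)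
      exact Finsupp.support_smul.trans (support_seqCoord (w2 p hp))
    · rw [map_sum]
      refine sum_congr rfl fun p hp => ?_
      rw [map_smul, bary_seqCoord, w1 p hp]
  obtain ⟨a, b⟩ := aux hz h1 h2 ht
  obtain ⟨a', b'⟩ := aux hz' h1' h2' ht'
  have hY := hK.inj a a' (by rw [b, b', hzz])
  refine eq_of_interleaved hc z z' hz hz' h1 h1' h3 h3' h4 h4' fun φ => ?_
  have := congrArg (Finsupp.linearCombination ℝ φ) hY
  have comp : ∀ (W : M → ℕ → M) (y : M →₀ ℝ), Finsupp.linearCombination ℝ φ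
      (Finsupp.linearCombination ℝ (seqCoord c W) y) =
      Finsupp.linearCombination ℝ (fun p => ∑ l ∈ range c, φ (W p l)) y := fun W y => by
    rw [linearCombination_eq_sum (seqCoord c W) subset_rfl, map_sum,
      linearCombination_eq_sum _ subset_rfl]
    exact sum_congr rfl fun p _ => by simp [seqCoord, map_sum]
  rwa [comp, comp] at this

end Uniqueness

section Existence

variable {M : Type*} [AddCommGroup M] [LinearOrder M] [IsOrderedAddMonoid M]

theorem exists_edgewiseFace_of_monotone {c s : ℕ} {t : Finset M} {g : ℕ → M}
    (hmono : ∀ i j, i ≤ j → j < c * s → g i ≤ g j) (hg : ∀ i < c * s, g i ∈ t) :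
    ∃ A, EdgewiseFace c t A ∧ ∑ i ∈ range (c * s), g i ∈ AddSubmonoid.closure (A : Set M) := by
  classical
  let P : ℕ → M := fun j => ∑ k ∈ range c, g (k * s + j)
  let A := (range s).image P
  have hA : ∀ p ∈ A, ∃ j, j < s ∧ P j = p := fun p hp => by simpa [A] using hp
  choose! J hJ hP using hA
  have hlt : ∀ k j, k < c → j < s → k * s + j < c * s := fun k j hk hj => by
    calc k * s + j < k * s + s := by omega
      _ = (k + 1) * s := by ring
      _ ≤ c * s := Nat.mul_le_mul_right s hk
  refine ⟨A, ⟨fun p k => g (k * s + J p), hP, fun p hp l hl => hg _ (hlt _ _ hl (hJ p hp)),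
    fun p hp q hq l l' hll hl' => hmono _ _ ?_ (hlt _ _ hl' (hJ q hq)),
    fun p hp q hq hpq l hl => ?_⟩, ?_⟩
  · have := hJ p hp
    calc l * s + J p ≤ l * s + s := by omega
      _ = (l + 1) * s := by ring
      _ ≤ l' * s := Nat.mul_le_mul_right s hll
      _ ≤ _ := Nat.le_add_right _ _
  · rcases le_total (J p) (J q) with h | h
    · exact hmono _ _ (by omega) (hlt _ _ hl (hJ q hq))
    · have : q ≤ p := by
        rw [← hP p hp, ← hP q hq]
        exact sum_le_sum fun k hk => hmono _ _ (by omega) (hlt _ _ (mem_range.1 hk) (hJ p hp))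
      rw [le_antisymm hpq this]
  · rw [sum_range_mul_add, sum_comm]
    exact sum_mem fun j hj => AddSubmonoid.subset_closure (mem_image_of_mem _ hj)

theorem exists_edgewiseFace_of_multiset {c s : ℕ} {t : Finset M} (m : Multiset M)
    (hm : ∀ v ∈ m, v ∈ t) (hcard : m.card = c * s) :
    ∃ A, EdgewiseFace c t A ∧ m.sum ∈ AddSubmonoid.closure (A : Set M) := by
  set L := m.sort (· ≤ ·) with hL
  have hlen : L.length = c * s := by rw [hL, Multiset.length_sort, hcard]
  have hsum : ∑ i ∈ range (c * s), L.getD i 0 = m.sum := by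
    rw [← hlen, ← Multiset.sort_eq m (· ≤ ·), Multiset.sum_coe, ← hL]
    rw [← Fin.sum_univ_getElem, ← Fin.sum_univ_eq_sum_range (fun i => L.getD i 0)]
    exact sum_congr rfl fun i _ => by simp
  rw [← hsum]
  refine exists_edgewiseFace_of_monotone (fun i j hij hj => ?_) fun i hi => ?_
  · have hs : L.SortedLE := (Multiset.pairwise_sort m (· ≤ ·)).sortedLE
    rw [List.getD_eq_getElem _ _ (by omega), List.getD_eq_getElem _ _ (by omega)]
    exact hs.monotone_get (a := ⟨i, by omega⟩) (b := ⟨j, by omega⟩) hij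
  · rw [List.getD_eq_getElem _ _ (by omega)]
    exact hm _ ((Multiset.mem_sort _).1 (List.getElem_mem _))

variable [Module ℝ M]

/-- A nonnegative integral combination of `t` whose number of summands is divisible by `c` is a
nonnegative integral combination of a face of the edgewise subdivision. -/
theorem exists_edgewiseFace {c : ℕ} {t : Finset M} {y : M →₀ ℝ} (h0 : 0 ≤ y)
    (ht : y.support ⊆ t) (hy : ∀ v, ∃ n : ℤ, y v = n) (htot : ∃ k : ℤ, total y = c * k) :
    ∃ A, EdgewiseFace c t A ∧ bary y ∈ AddSubmonoid.closure (A : Set M) := by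
  have hy' : ∀ v, ∃ n : ℕ, y v = n := fun v => by
    obtain ⟨n, hn⟩ := hy v
    have : (0 : ℝ) ≤ n := hn ▸ h0 v
    lift n to ℕ using (by exact_mod_cast this)
    exact ⟨n, by simpa using hn⟩
  choose n hn using hy'
  have e1 : total y = ((∑ v ∈ t, n v : ℕ) : ℝ) := by
    rw [linearCombination_eq_sum _ ht]
    simp [hn]
  obtain ⟨k, hk⟩ := htot
  obtain ⟨s, hs⟩ : (c : ℤ) ∣ ((∑ v ∈ t, n v : ℕ) : ℤ) := ⟨k, by rw [e1] at hk; exact_mod_cast hk⟩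
  obtain ⟨s, hs⟩ : c ∣ ∑ v ∈ t, n v := by exact_mod_cast Dvd.intro s hs.symm
  obtain ⟨A, hA, h⟩ := exists_edgewiseFace_of_multiset (t := t) (c := c) (s := s)
    (∑ v ∈ t, Multiset.replicate (n v) v) (fun v hv => by
      rw [Multiset.mem_sum] at hv
      obtain ⟨i, hi, hv⟩ := hv
      rwa [Multiset.eq_of_mem_replicate hv]) (by simp [hs])
  refine ⟨A, hA, ?_⟩
  convert h using 1
  rw [bary_eq_sum ht]
  have hs := map_sum (Multiset.sumAddMonoidHom : Multiset M →+ M)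
    (fun v => Multiset.replicate (n v) v) t
  rw [Multiset.coe_sumAddMonoidHom] at hs
  rw [hs]
  refine sum_congr rfl fun v _ => ?_
  simp [hn, Nat.cast_smul_eq_nsmul]

theorem mem_addSubmonoid_closure {s : Finset M} {x : M}
    (h : x ∈ AddSubmonoid.closure (s : Set M)) :
    ∃ y : M →₀ ℝ, 0 ≤ y ∧ y.support ⊆ s ∧ (∀ v, ∃ n : ℤ, y v = n) ∧ bary y = x := by
  induction h using AddSubmonoid.closure_induction with
  | mem x hx =>
    refine ⟨Finsupp.single x 1, by simp, (Finsupp.support_single_subset).trans (by simpa using hx),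
      fun v => ?_, by simp⟩
    by_cases h : x = v
    · exact ⟨1, by simp [h]⟩
    · exact ⟨0, by simp [h]⟩
  | zero => exact ⟨0, le_rfl, by simp, fun v => ⟨0, by simp⟩, by simp⟩
  | add a b _ _ ha hb =>
    obtain ⟨y, h0, hy, hy', rfl⟩ := ha
    obtain ⟨z, h0', hz, hz', rfl⟩ := hb
    refine ⟨y + z, add_nonneg h0 h0', Finsupp.support_add.trans (union_subset hy hz), fun v => ?_,
      by simp⟩
    obtain ⟨n, hn⟩ := hy' v
    obtain ⟨m, hm⟩ := hz' v
    exact ⟨n + m, by simp [hn, hm]⟩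

/-- Saturation: the lattice generated by the vertices of a face of the edgewise subdivision
consists of all integral combinations of the original vertices in its span whose coefficient sum
is divisible by `c`. -/
theorem IsFan.mem_closure_of_edgewiseFace {K : Set (Finset M)} (hK : IsFan K) {c : ℕ} (hc : 0 < c)
    {t A : Finset M} (ht : t ∈ K) (hA : EdgewiseFace c t A) {n : M →₀ ℝ} (hn : n.support ⊆ t)
    (hnint : ∀ v, ∃ k : ℤ, n v = k) (htot : ∃ k : ℤ, total n = c * k)
    (hx : bary n ∈ Submodule.span ℝ (A : Set M)) : bary n ∈ AddSubgroup.closure (A : Set M) := by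
  obtain ⟨w, hw, hwx⟩ := mem_span_iff.1 hx
  obtain ⟨V, h1, h2, -⟩ := id hA
  obtain ⟨N, hN⟩ : ∃ N : ℕ, ∀ p ∈ A, -w p ≤ N := by
    obtain ⟨N, hN⟩ := exists_nat_ge (∑ p ∈ A, |w p|)
    exact ⟨N, fun p hp => (neg_le_abs _).trans
      ((single_le_sum (f := fun p => |w p|) (fun _ _ => abs_nonneg _) hp).trans hN)⟩
  set X := ∑ p ∈ A, seqCoord c V p with hX
  set S : M →₀ ℝ := ∑ p ∈ A, Finsupp.single p 1 with hS
  have hSA : S.support ⊆ A := Finsupp.support_finsetSum.trans (Finset.biUnion_subset.2 fun p hp =>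
    Finsupp.support_single_subset.trans (by simpa using hp))
  have hSp : ∀ p ∈ A, S p = 1 := fun p hp => by
    simp [hS, Finsupp.single_apply, hp]
  have hbS : bary S = ∑ p ∈ A, p := by simp [hS, map_sum]
  have hbX : bary X = ∑ p ∈ A, p := by
    rw [hX, map_sum]
    exact sum_congr rfl fun p hp => by rw [bary_seqCoord, h1 p hp]
  have hXt : X.support ⊆ t := Finsupp.support_finsetSum.trans (Finset.biUnion_subset.2 fun p hp =>
    support_seqCoord (h2 p hp))
  set z := w + (N : ℝ) • S with hz
  have hzA : z.support ⊆ A := Finsupp.support_add.trans (union_subset hw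
    (Finsupp.support_smul.trans hSA))
  have hz0 : 0 ≤ z := fun p => by
    by_cases hp : p ∈ A
    · have := hN p hp
      simp only [hz, Finsupp.coe_add, Finsupp.coe_smul, Pi.add_apply, Pi.smul_apply, hSp p hp]
      simp
      linarith
    · rw [Finsupp.notMem_support_iff.1 fun h => hp (hzA h)]
      simp
  have hbz : bary z = bary n + (N : ℝ) • ∑ p ∈ A, p := by
    rw [hz, map_add, map_smul, hwx, hbS]
  set Y := ∑ p ∈ A, z p • seqCoord c V p with hY
  have hY0 : 0 ≤ Y := sum_nonneg fun p _ => smul_nonneg (hz0 p) (seqCoord_nonneg _ _ _)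
  have hYt : Y.support ⊆ t := Finsupp.support_finsetSum.trans (Finset.biUnion_subset.2 fun p hp =>
    Finsupp.support_smul.trans (support_seqCoord (h2 p hp)))
  have hbY : bary Y = bary z := by
    rw [hY, map_sum, bary_eq_sum hzA]
    exact sum_congr rfl fun p hp => by rw [map_smul, bary_seqCoord, h1 p hp]
  have hYn : Y = n + (N : ℝ) • X := hK.ext_of_subset ht hYt
    (Finsupp.support_add.trans (union_subset hn (Finsupp.support_smul.trans hXt)))
    (by rw [hbY, hbz, map_add, map_smul, hbX])
  obtain ⟨B, hB, hYB⟩ := exists_edgewiseFace (c := c) hY0 hYt (fun v => by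
    obtain ⟨k, hk⟩ := hnint v
    choose m hm using fun p => seqCoord_int c V p v
    refine ⟨k + N * ∑ p ∈ A, m p, ?_⟩
    rw [hYn, Finsupp.coe_add, Pi.add_apply, hk, Finsupp.smul_apply, hX, Finsupp.finsetSum_apply]
    simp [hm]) (by
    obtain ⟨k, hk⟩ := htot
    refine ⟨k + N * A.card, ?_⟩
    rw [hYn, map_add, hk, map_smul, hX, map_sum, sum_congr rfl fun p _ => total_seqCoord c V p]
    simp
    ring)
  obtain ⟨z', hz0', hzB, hnint', hbz'⟩ := mem_addSubmonoid_closure hYB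
  have hE := hK.edgewise hc
  have hzz : z = z' := hE.inj ⟨hz0, hE.down A ⟨t, ht, hA⟩ _ hzA⟩
    ⟨hz0', hE.down B ⟨t, ht, hB⟩ _ hzB⟩ (by rw [hbz', hbY])
  have : bary n = bary z - N • ∑ p ∈ A, p := by
    rw [hbz, Nat.cast_smul_eq_nsmul]; abel
  rw [this]
  refine sub_mem (mem_closure_iff.2 ⟨z, hzA, hzz ▸ hnint', rfl⟩)
    (nsmul_mem (sum_mem fun p hp => AddSubgroup.subset_closure hp) N)

end Existence

theorem finite_edgewiseFace {M : Type*} [AddCommGroup M] [LinearOrder M] (c : ℕ) (t : Finset M) :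
    {A | EdgewiseFace c t A}.Finite := by
  classical
  refine ((Fintype.piFinset fun _ : Fin c => t).image
    fun f => ∑ i, f i).powerset.finite_toSet.subset
    ?_
  rintro A ⟨V, h1, h2, -⟩
  rw [Finset.mem_coe, mem_powerset]
  intro p hp
  rw [mem_image]
  refine ⟨fun i => V p i, Fintype.mem_piFinset.2 fun i => h2 p hp i i.2, ?_⟩
  rw [Fin.sum_univ_eq_sum_range (V p), h1 p hp]

theorem finite_edgewise {M : Type*} [AddCommGroup M] [LinearOrder M] (c : ℕ) {K : Set (Finset M)}
    (hK : K.Finite) : (edgewise c K).Finite := by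
  have : edgewise c K = ⋃ t ∈ K, {A | EdgewiseFace c t A} := by
    ext; simp [edgewise]
  rw [this]
  exact hK.biUnion fun t _ => finite_edgewiseFace c t

section Topological

variable {M : Type*} [AddCommGroup M] [Module ℝ M] [TopologicalSpace M] [IsTopologicalAddGroup M]
  [ContinuousSMul ℝ M] [T2Space M]

theorem IsFan.isClosed_coneOf {K : Set (Finset M)} (hK : IsFan K) {t : Finset M} (ht : t ∈ K) :
    IsClosed (coneOf t) := by
  classical
  let f : (t → ℝ) →ₗ[ℝ] M := Fintype.linearCombination ℝ (fun v : t => (v : M))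
  have hf : ∀ y, f y = ∑ v : t, y v • (v : M) := fun y => Fintype.linearCombination_apply ..
  have key : ∀ y : t → ℝ, ∃ z : M →₀ ℝ, z.support ⊆ t ∧ (∀ v : t, z v = y v) ∧ bary z = f y := by
    intro y
    let z : M →₀ ℝ := Finsupp.onFinset t (fun v => if h : v ∈ t then y ⟨v, h⟩ else 0)
      (fun v hv => by by_contra h; simp [h] at hv)
    have hz : z.support ⊆ t := Finsupp.support_onFinset_subset
    refine ⟨z, hz, fun v => by simp [z], ?_⟩
    rw [bary_eq_sum hz, hf, ← sum_coe_sort t]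
    exact sum_congr rfl fun v _ => by simp [z]
  have hker : LinearMap.ker f = ⊥ := by
    rw [LinearMap.ker_eq_bot']
    intro y hy
    obtain ⟨z, h1, h2, h3⟩ := key y
    have : z = 0 := hK.ext_of_subset ht h1 (by simp) (by rw [h3, hy, map_zero])
    ext v
    rw [← h2 v, this]; rfl
  have he := LinearMap.isClosedEmbedding_of_injective hker
  have hi : coneOf t = f '' {y | ∀ v, 0 ≤ y v} := by
    ext x
    constructor
    · rintro ⟨y, h0, hy, rfl⟩
      refine ⟨fun v => y v, fun v => h0 v, ?_⟩
      rw [hf, bary_eq_sum hy, ← sum_coe_sort t]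
    · rintro ⟨y, h0, rfl⟩
      obtain ⟨z, h1, h2, h3⟩ := key y
      refine ⟨z, fun v => ?_, h1, h3⟩
      by_cases hv : v ∈ t
      · rw [h2 ⟨v, hv⟩]; exact h0 _
      · rw [Finsupp.notMem_support_iff.1 fun h => hv (h1 h)]; simp
  rw [hi]
  refine he.isClosedMap _ ?_
  simp only [Set.ofPred_forall]
  exact isClosed_iInter fun v => isClosed_le continuous_const (continuous_apply v)

theorem IsFan.isClosed_carrier {K : Set (Finset M)} (hK : IsFan K) (hfin : K.Finite) :
    IsClosed (carrier K) := by
  rw [carrier_eq_iUnion hK.down]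
  exact hfin.isClosed_biUnion fun t ht => hK.isClosed_coneOf ht

variable [LinearOrder M] [IsOrderedAddMonoid M]

theorem IsFan.exists_edgewiseFace {K : Set (Finset M)} (hK : IsFan K) {c : ℕ} (hc : 0 < c)
    {t : Finset M} (ht : t ∈ K) {x : M} (hx : x ∈ coneOf t) :
    ∃ A, EdgewiseFace c t A ∧ x ∈ coneOf A := by
  have hE := hK.edgewise hc
  have hclosed : IsClosed (⋃ A ∈ {A | EdgewiseFace c t A}, coneOf A) :=
    (finite_edgewiseFace c t).isClosed_biUnion fun A hA => hE.isClosed_coneOf ⟨t, ht, hA⟩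
  suffices x ∈ ⋃ A ∈ {A | EdgewiseFace c t A}, coneOf A by simpa using this
  obtain ⟨y, h0, hy, rfl⟩ := hx
  have hlim : Tendsto (fun n : ℕ => ∑ v ∈ t, ((⌊y v * (n : ℝ)⌋₊ : ℝ) / n) • v) atTop
      (𝓝 (bary y)) := by
    rw [bary_eq_sum hy]
    refine tendsto_finsetSum _ fun v _ => Tendsto.smul_const ?_ v
    exact (tendsto_nat_floor_mul_div_atTop (h0 v)).comp tendsto_natCast_atTop_atTop
  refine hclosed.mem_of_tendsto hlim (Eventually.of_forall fun n => ?_)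
  let w : M →₀ ℝ := y.mapRange (fun r : ℝ => (c : ℝ) * (⌊r * (n : ℝ)⌋₊ : ℝ)) (by simp)
  have hw : w.support ⊆ t := Finsupp.support_mapRange.trans hy
  obtain ⟨A, hA, hwA⟩ := EdgewiseFan.exists_edgewiseFace (c := c) (y := w) (fun v => by
    simp only [w, Finsupp.mapRange_apply, Finsupp.coe_zero, Pi.zero_apply]; positivity) hw
    (fun v => ⟨c * ⌊y v * n⌋₊, by simp [w]⟩)
    ⟨∑ v ∈ t, (⌊y v * n⌋₊ : ℤ), by
      rw [linearCombination_eq_sum _ hw]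
      simp [w, mul_sum]⟩
  obtain ⟨z, z0, hz, -, hzw⟩ := mem_addSubmonoid_closure hwA
  have hmem : bary w ∈ coneOf A := ⟨z, z0, hz, hzw⟩
  have : ∑ v ∈ t, ((⌊y v * (n : ℝ)⌋₊ : ℝ) / n) • v = ((c : ℝ) * n)⁻¹ • bary w := by
    rw [bary_eq_sum hw, smul_sum]
    refine sum_congr rfl fun v _ => ?_
    rw [smul_smul]
    congr 1
    have : (c : ℝ) ≠ 0 := by exact_mod_cast hc.ne'
    rcases eq_or_ne (n : ℝ) 0 with h | h
    · simp [w, h]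
    · simp only [w, Finsupp.mapRange_apply]
      field_simp
  rw [this]
  exact Set.mem_biUnion hA (smul_mem_coneOf (by positivity) hmem)

/-- The edgewise subdivision does not change the union of the cones. -/
theorem IsFan.carrier_edgewise {K : Set (Finset M)} (hK : IsFan K) {c : ℕ} (hc : 0 < c) :
    carrier (EdgewiseFan.edgewise c K) = carrier K := by
  rw [carrier_eq_iUnion hK.down, carrier_eq_iUnion (hK.edgewise hc).down]
  refine subset_antisymm (Set.iUnion₂_subset fun A ⟨t, ht, hA⟩ => ?_)
    (Set.iUnion₂_subset fun t ht x hx => ?_)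
  · exact (coneOf_trans fun p hp => hA.mem_coneOf hp).trans (Set.subset_biUnion_of_mem ht)
  · obtain ⟨A, hA, hxA⟩ := hK.exists_edgewiseFace hc ht hx
    exact Set.mem_biUnion (show A ∈ EdgewiseFan.edgewise c K from ⟨t, ht, hA⟩) hxA

end Topological

section Insert

variable {M : Type*} [AddCommGroup M] [Module ℝ M] [DecidableEq M]

theorem bary_erase_add (y : M →₀ ℝ) (p : M) : bary (y.erase p) + y p • p = bary y := by
  conv_rhs => rw [← Finsupp.erase_add_single p y]
  simp

theorem erase_nonneg {y : M →₀ ℝ} (hy : 0 ≤ y) (p : M) : 0 ≤ y.erase p := fun v => by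
  by_cases h : v = p
  · simp [h]
  · rw [Finsupp.erase_ne h]; exact hy v

theorem mem_coneOf_insert {s : Finset M} {p x : M} :
    x ∈ coneOf (insert p s) ↔ ∃ d ∈ coneOf s, ∃ ε : ℝ, 0 ≤ ε ∧ d + ε • p = x := by
  constructor
  · rintro ⟨y, h0, hy, rfl⟩
    refine ⟨_, ⟨y.erase p, erase_nonneg h0 p, ?_, rfl⟩, y p, h0 p, bary_erase_add y p⟩
    rw [Finsupp.support_erase]
    exact (erase_subset_erase _ hy).trans (erase_insert_subset _ _)
  · rintro ⟨d, hd, ε, hε, rfl⟩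
    exact add_mem_coneOf (coneOf_mono (subset_insert _ _) hd)
      (smul_mem_coneOf hε (mem_coneOf_of_mem (mem_insert_self _ _)))

end Insert

theorem exists_pos_mul_le {ι : Type*} {t : Finset ι} {y w : ι → ℝ} (hy : ∀ v ∈ t, 0 < y v) {e : ℝ}
    (he : 0 < e) (δ : ℝ) : ∃ η : ℝ, 0 < η ∧ η * δ < e ∧ ∀ v ∈ t, η * w v < y v := by
  have h : ∀ a b : ℝ, 0 < b → ∀ᶠ η : ℝ in 𝓝[>] 0, η * a < b := fun a b hb => by
    have : Tendsto (fun η : ℝ => η * a) (𝓝[>] 0) (𝓝 (0 * a)) :=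
      ((continuous_id.mul continuous_const).tendsto 0).mono_left nhdsWithin_le_nhds
    rw [zero_mul] at this
    exact this.eventually_lt_const hb
  have := (eventually_mem_nhdsWithin (a := (0 : ℝ)) (s := Set.Ioi 0)).and ((h δ e he).and
    ((Filter.eventually_all_finset t).2 fun v hv => h (w v) (y v) (hy v hv)))
  exact this.exists

theorem pos_of_mem_support {M : Type*} {y : M →₀ ℝ} (h : 0 ≤ y) {p : M} (hp : p ∈ y.support) :
    0 < y p :=
  lt_of_le_of_ne (h p) (Ne.symm (Finsupp.mem_support_iff.1 hp))

section Placing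

variable {M : Type*} [AddCommGroup M] [Module ℝ M]

/-- `t` is visible from `p` with respect to `D`. -/
def Visible (D : Set M) (p : M) (t : Finset M) : Prop :=
  ∀ x ∈ coneOf t, ∀ ε : ℝ, 0 < ε → x + ε • p ∉ D

variable [DecidableEq M]

/-- The fan obtained from `K` by placing the new ray `p`. -/
def placing (K : Set (Finset M)) (p : M) : Set (Finset M) :=
  K ∪ {s | ∃ t ∈ K, Visible (carrier K) p t ∧ s = insert p t}

theorem mem_of_mem_placing {K : Set (Finset M)} (hK : ∀ s ∈ K, ∀ t ⊆ s, t ∈ K) {p : M}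
    {s : Finset M} (hs : s ∈ placing K p) : s.erase p ∈ K := by
  rcases hs with hs | ⟨t, ht, -, rfl⟩
  · exact hK _ hs _ (erase_subset _ _)
  · exact hK _ ht _ (erase_insert_subset _ _)

theorem IsFan.placing {K : Set (Finset M)} (hK : IsFan K) {p : M} (hp : p ∉ carrier K) :
    IsFan (placing K p) := by
  have hpt : ∀ t ∈ K, p ∉ t := fun t ht h => hp <| by
    rw [carrier_eq_iUnion hK.down]
    exact Set.mem_biUnion ht (mem_coneOf_of_mem h)
  constructor
  · rintro s (hs | ⟨t, ht, hv, rfl⟩) s' hs'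
    · exact Or.inl (hK.down s hs s' hs')
    · have h1 : s'.erase p ⊆ t := (erase_subset_erase _ hs').trans (erase_insert_subset _ _)
      by_cases h : p ∈ s'
      · exact Or.inr ⟨s'.erase p, hK.down t ht _ h1, fun x hx => hv x (coneOf_mono h1 hx),
          (insert_erase h).symm⟩
      · rw [erase_eq_of_notMem h] at h1
        exact Or.inl (hK.down t ht _ h1)
  · have key : ∀ z ∈ coeffs (EdgewiseFan.placing K p), ∀ z' ∈ coeffs (EdgewiseFan.placing K p),
        bary z = bary z' → z p ≤ z' p := by
      intro z ⟨hz, hzs⟩ z' ⟨hz', hzs'⟩ h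
      by_contra! hlt
      have hpz : p ∈ z.support := Finsupp.mem_support_iff.2 ((hz' p).trans_lt hlt).ne'
      rcases hzs with hs | ⟨t, ht, hv, hs⟩
      · exact hpt _ hs hpz
      · refine hv (bary (z.erase p)) ⟨_, erase_nonneg hz p, ?_, rfl⟩ (z p - z' p) (sub_pos.2 hlt)
          ⟨z'.erase p, ⟨erase_nonneg hz' p, ?_⟩, ?_⟩
        · rw [Finsupp.support_erase, hs]
          exact erase_insert_subset _ _
        · rw [Finsupp.support_erase]
          exact mem_of_mem_placing hK.down hzs'
        · rw [← bary_erase_add z p, ← bary_erase_add z' p] at h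
          rw [sub_smul, ← add_sub_assoc, h, add_sub_cancel_right]
    intro z hz z' hz' h
    have hpp : z p = z' p := le_antisymm (key z hz z' hz' h) (key z' hz' z hz h.symm)
    rw [← Finsupp.erase_add_single p z, ← Finsupp.erase_add_single p z', hpp]
    congr 1
    refine hK.inj ⟨erase_nonneg hz.1 p, ?_⟩ ⟨erase_nonneg hz'.1 p, ?_⟩ ?_
    · rw [Finsupp.support_erase]; exact mem_of_mem_placing hK.down hz.2
    · rw [Finsupp.support_erase]; exact mem_of_mem_placing hK.down hz'.2
    · rw [← bary_erase_add z p, ← bary_erase_add z' p, hpp] at h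
      exact add_right_cancel h

variable [TopologicalSpace M] [IsTopologicalAddGroup M] [ContinuousSMul ℝ M] [T2Space M]

theorem carrier_placing {K : Set (Finset M)} (hK : IsFan K) (hfin : K.Finite) {V : Finset M}
    (hV : ∀ t ∈ K, t ⊆ V) (hcar : carrier K = coneOf V) {p : M} (hp : p ∉ carrier K) :
    carrier (placing K p) = coneOf (insert p V) := by
  have hK' := hK.placing hp
  ext x
  rw [mem_coneOf_insert]
  constructor
  · rintro ⟨z, ⟨hz, hzs⟩, rfl⟩
    refine ⟨bary (z.erase p), ⟨_, erase_nonneg hz p, ?_, rfl⟩, z p, hz p, bary_erase_add z p⟩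
    rw [Finsupp.support_erase]
    exact hV _ (mem_of_mem_placing hK.down hzs)
  · rintro ⟨d, hd, ε, hε, rfl⟩
    set x := d + ε • p with hx
    have hclosed : IsClosed {e : ℝ | x - e • p ∈ carrier K} :=
      (hK.isClosed_carrier hfin).preimage (by fun_prop)
    obtain ⟨e, ⟨⟨he0, heε⟩, he⟩, hmin⟩ := ((isCompact_Icc (a := (0 : ℝ)) (b := ε)).inter_right
      hclosed).exists_isLeast ⟨ε, ⟨hε, le_rfl⟩, by
        simpa [hx, hcar] using hd⟩
    obtain ⟨y, ⟨hy, hyK⟩, hyx⟩ := he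
    rcases he0.eq_or_lt with rfl | he0
    · rw [zero_smul, sub_zero] at hyx
      exact ⟨y, ⟨hy, Or.inl hyK⟩, hyx⟩
    have hvis : Visible (carrier K) p y.support := by
      rintro _ ⟨w, hw, hws, rfl⟩ δ hδ hmem
      obtain ⟨η, hη, hηe, hηy⟩ := exists_pos_mul_le (w := w) (fun v hv => pos_of_mem_support hy hv)
        he0 δ
      refine absurd (hmin (a := e - η * δ) ⟨⟨by linarith, ?_⟩, ?_⟩) ?_
      · have := mul_pos hη hδ; linarith
      · show x - (e - η * δ) • p ∈ carrier K
        have e1 : x - (e - η * δ) • p = bary (y - η • w) + η • (bary w + δ • p) := by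
          rw [map_sub, hyx, map_smul, smul_add, smul_smul, sub_smul]; abel
        rw [e1, hcar]
        refine add_mem_coneOf ⟨y - η • w, fun v => ?_, ?_, rfl⟩
          (smul_mem_coneOf hη.le (hcar ▸ hmem))
        · by_cases hv : v ∈ y.support
          · have := hηy v hv
            simp; linarith
          · have h1 := Finsupp.notMem_support_iff.1 hv
            have h2 := Finsupp.notMem_support_iff.1 fun h => hv (hws h)
            simp [h1, h2]
        · exact Finsupp.support_sub.trans (union_subset (hV _ hyK)
            ((Finsupp.support_smul.trans hws).trans (hV _ hyK)))
      · have := mul_pos hη hδ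
        simp only [not_le]; linarith
    rw [carrier_eq_iUnion hK'.down]
    refine Set.mem_biUnion (show insert p y.support ∈ placing K p from
      Or.inr ⟨_, hyK, hvis, rfl⟩) (mem_coneOf_insert.2 ⟨_, ⟨y, hy, subset_rfl, rfl⟩, e, he0.le, ?_⟩)
    rw [hyx, sub_add_cancel]

theorem exists_isFan (V : Finset M) :
    ∃ K : Set (Finset M), IsFan K ∧ K.Finite ∧ (∀ t ∈ K, t ⊆ V) ∧ carrier K = coneOf V := by
  induction V using Finset.induction_on with
  | empty =>
    have h0 : coeffs ({∅} : Set (Finset M)) = {0} := by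
      ext y; simp only [coeffs, Set.mem_singleton_iff, Set.mem_ofPred_eq, Finsupp.support_eq_empty]
      exact ⟨fun h => h.2, by rintro rfl; exact ⟨le_rfl, rfl⟩⟩
    refine ⟨{∅}, ⟨by simp, by rw [h0]; exact Set.injOn_singleton _ _⟩, Set.finite_singleton _,
      by simp, ?_⟩
    ext x
    simp only [carrier, h0, Set.image_singleton, map_zero, Set.mem_singleton_iff, coneOf,
      Set.mem_ofPred_eq, subset_empty, Finsupp.support_eq_empty]
    constructor
    · rintro rfl; exact ⟨0, le_rfl, rfl, map_zero _⟩
    · rintro ⟨_, -, rfl, rfl⟩; exact map_zero _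
  | insert p V hp ih =>
    obtain ⟨K, hK, hfin, hV, hcar⟩ := ih
    by_cases hpD : p ∈ carrier K
    · refine ⟨K, hK, hfin, fun t ht => (hV t ht).trans (subset_insert _ _), hcar.trans ?_⟩
      refine subset_antisymm (coneOf_mono (subset_insert _ _)) (coneOf_trans fun q hq => ?_)
      rcases mem_insert.1 hq with rfl | hq
      · exact hcar ▸ hpD
      · exact mem_coneOf_of_mem hq
    · refine ⟨placing K p, hK.placing hpD, ?_, ?_, carrier_placing hK hfin hV hcar hpD⟩
      · refine hfin.union ((hfin.image (insert p)).subset ?_)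
        rintro _ ⟨t, ht, -, rfl⟩
        exact ⟨t, ht, rfl⟩
      · rintro s (hs | ⟨t, ht, -, rfl⟩)
        · exact (hV s hs).trans (subset_insert _ _)
        · exact insert_subset_insert _ (hV t ht)

end Placing

section Index

variable {M : Type*} [AddCommGroup M]

theorem relIndex_le_relIndex {A₁ A₂ B₁ B₂ : AddSubgroup M} (hA : A₁ ≤ A₂) (hB : B₂ ⊓ A₁ ≤ B₁)
    (h0 : B₂.relIndex A₂ ≠ 0) : B₁.relIndex A₁ ≤ B₂.relIndex A₂ := by
  have h1 : B₂.relIndex A₁ ≠ 0 := fun h => h0 (AddSubgroup.relIndex_eq_zero_of_le_right hA h)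
  refine le_trans ?_ (AddSubgroup.relIndex_le_of_le_right hA h0)
  rw [← AddSubgroup.inf_relIndex_right B₂] at h1 ⊢
  exact AddSubgroup.relIndex_le_of_le_left hB h1

theorem le_sup_of_relIndex_le {A₁ A₂ B : AddSubgroup M} (hA : A₁ ≤ A₂) (hB : B ≤ A₂)
    (h0 : B.relIndex A₂ ≠ 0) (h : B.relIndex A₂ ≤ B.relIndex A₁) : A₂ ≤ A₁ ⊔ B := by
  have h1 := AddSubgroup.relIndex_mul_relIndex B (A₁ ⊔ B) A₂ le_sup_right (sup_le hA hB)
  rw [AddSubgroup.relIndex_sup_right] at h1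
  refine AddSubgroup.relIndex_eq_one.1 (le_antisymm ?_ ?_)
  · by_contra! h2
    have h3 : 0 < B.relIndex A₁ := Nat.pos_of_ne_zero fun h => h0 (by rw [← h1, h, zero_mul])
    have := Nat.mul_lt_mul_of_pos_left h2 h3
    omega
  · exact Nat.pos_of_ne_zero fun h => h0 (by rw [← h1, h, mul_zero])

theorem relIndex_zmultiples_dvd {H : AddSubgroup M} {x : M} {m : ℤ} (h : m • x ∈ H) :
    H.relIndex (AddSubgroup.zmultiples x) ∣ m.natAbs := by
  rw [← AddSubgroup.range_zmultiplesHom, ← AddSubgroup.index_comap, ← Int.index_zmultiples]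
  refine AddSubgroup.index_dvd_of_le ?_
  exact AddSubgroup.zmultiples_le_of_mem (by simpa using h)

variable [Module ℝ M]

/-- The index of the lattice generated by `s` in the lattice of all points of `Λ` in its span. -/
noncomputable def ind (Λ : AddSubgroup M) (s : Finset M) : ℕ :=
  (AddSubgroup.closure (s : Set M)).relIndex (Λ ⊓ (Submodule.span ℝ (s : Set M)).toAddSubgroup)

/-- Every zonotope contains only finitely many points of `Λ`. -/
def BoxFinite (Λ : AddSubgroup M) : Prop :=
  ∀ s : Finset M, {x | x ∈ Λ ∧ ∃ y : M →₀ ℝ, y.support ⊆ s ∧ (∀ v, 0 ≤ y v ∧ y v ≤ 1) ∧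
    bary y = x}.Finite

theorem BoxFinite.mono {Λ Λ' : AddSubgroup M} (h : BoxFinite Λ) (hle : Λ' ≤ Λ) : BoxFinite Λ' :=
  fun s => (h s).subset fun _ hx => ⟨hle hx.1, hx.2⟩

theorem closure_le_inf {Λ : AddSubgroup M} {s : Finset M} (hs : ∀ v ∈ s, v ∈ Λ) :
    AddSubgroup.closure (s : Set M) ≤ Λ ⊓ (Submodule.span ℝ (s : Set M)).toAddSubgroup :=
  (AddSubgroup.closure_le _).2 fun v hv => ⟨hs v hv, Submodule.subset_span hv⟩

theorem exists_fract {y : M →₀ ℝ} {s : Finset M} (hy : y.support ⊆ s) :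
    ∃ w : M →₀ ℝ, w.support ⊆ s ∧ (∀ v, 0 ≤ w v ∧ w v < 1) ∧
      bary y - bary w ∈ AddSubgroup.closure (s : Set M) := by
  refine ⟨y.mapRange Int.fract (by simp), Finsupp.support_mapRange.trans hy,
    fun v => ⟨by simp [Int.fract_nonneg], by simp [Int.fract_lt_one]⟩, ?_⟩
  rw [← map_sub]
  refine mem_closure_iff.2 ⟨_, ?_, fun v => ⟨⌊y v⌋, ?_⟩, rfl⟩
  · classical
    exact Finsupp.support_sub.trans (union_subset hy (Finsupp.support_mapRange.trans hy))
  · simp [Int.self_sub_fract]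

theorem ind_ne_zero {Λ : AddSubgroup M} (hΛ : BoxFinite Λ) {s : Finset M} (hs : ∀ v ∈ s, v ∈ Λ) :
    ind Λ s ≠ 0 := by
  set A := Λ ⊓ (Submodule.span ℝ (s : Set M)).toAddSubgroup with hA
  have hF : Finite {x : A // x.1 ∈ {x | x ∈ Λ ∧ ∃ y : M →₀ ℝ, y.support ⊆ s ∧
      (∀ v, 0 ≤ y v ∧ y v ≤ 1) ∧ bary y = x}} :=
    ((hΛ s).preimage Subtype.val_injective.injOn).to_subtype
  have : Finite (A ⧸ (AddSubgroup.closure (s : Set M)).addSubgroupOf A) := by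
    refine Finite.of_surjective (fun x : {x : A // x.1 ∈ {x | x ∈ Λ ∧ ∃ y : M →₀ ℝ,
      y.support ⊆ s ∧ (∀ v, 0 ≤ y v ∧ y v ≤ 1) ∧ bary y = x}} => (x.1 : A ⧸ _)) fun q => ?_
    induction q using QuotientAddGroup.induction_on with
    | H x =>
    obtain ⟨x, hxΛ, hx⟩ := x
    obtain ⟨y, hy, rfl⟩ := mem_span_iff.1 hx
    obtain ⟨w, hw, hw1, hd⟩ := exists_fract hy
    have hwA : bary w ∈ A := by
      have := sub_mem (show bary y ∈ A from ⟨hxΛ, hx⟩) (closure_le_inf hs hd)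
      rwa [sub_sub_cancel] at this
    refine ⟨⟨⟨bary w, hwA⟩, hwA.1, w, hw, fun v => ⟨(hw1 v).1, (hw1 v).2.le⟩, rfl⟩, ?_⟩
    rw [QuotientAddGroup.eq, AddSubgroup.mem_addSubgroupOf]
    simpa [sub_eq_neg_add] using hd
  exact AddSubgroup.index_ne_zero_of_finite

variable [DecidableEq M]

/-- Starring at a lattice point strictly decreases the index. -/
theorem relIndex_insert_erase_lt {Λ : AddSubgroup M} {σ : Finset M}
    (hli : ∀ x y : M →₀ ℝ, x.support ⊆ σ → y.support ⊆ σ → bary x = bary y → x = y)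
    (hσ : ∀ v ∈ σ, v ∈ Λ) (hind : ind Λ σ ≠ 0) {y : M →₀ ℝ} (hy : y.support ⊆ σ)
    (hyΛ : bary y ∈ Λ) {i : M} (hi : i ∈ σ) (h0 : 0 < y i) (h1 : y i < 1) :
    (AddSubgroup.closure ((insert (bary y) (σ.erase i) : Finset M) : Set M)).relIndex
      (Λ ⊓ (Submodule.span ℝ (σ : Set M)).toAddSubgroup) < ind Λ σ := by
  set A := Λ ⊓ (Submodule.span ℝ (σ : Set M)).toAddSubgroup with hA
  set L := AddSubgroup.closure (σ : Set M) with hL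
  set b := bary y
  set L' := AddSubgroup.closure ((insert b (σ.erase i) : Finset M) : Set M) with hL'
  have hbA : b ∈ A := ⟨hyΛ, mem_span_iff.2 ⟨y, hy, rfl⟩⟩
  have hLA : L ≤ A := closure_le_inf hσ
  have hbL' : b ∈ L' := AddSubgroup.subset_closure (by simp)
  have hEL' : ∀ v ∈ σ, v ≠ i → v ∈ L' := fun v hv hvi =>
    AddSubgroup.subset_closure (by simp [hv, hvi])
  have hM : L ⊔ AddSubgroup.zmultiples b = L' ⊔ AddSubgroup.zmultiples i := by
    apply le_antisymm
    · refine sup_le ((AddSubgroup.closure_le _).2 fun v hv => ?_) ?_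
      · by_cases hvi : v = i
        · exact (le_sup_right : _ ≤ L' ⊔ _) (hvi ▸ AddSubgroup.mem_zmultiples v)
        · exact (le_sup_left : L' ≤ _) (hEL' v hv hvi)
      · exact AddSubgroup.zmultiples_le_of_mem ((le_sup_left : L' ≤ _) hbL')
    · refine sup_le ((AddSubgroup.closure_le _).2 fun v hv => ?_) ?_
      · rw [Finset.mem_coe, mem_insert, mem_erase] at hv
        rcases hv with rfl | hv
        · exact (le_sup_right : _ ≤ L ⊔ _) (AddSubgroup.mem_zmultiples _)
        · exact (le_sup_left : L ≤ _) (AddSubgroup.subset_closure hv.2)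
      · exact AddSubgroup.zmultiples_le_of_mem
          ((le_sup_left : L ≤ _) (AddSubgroup.subset_closure hi))
  have hMA : L ⊔ AddSubgroup.zmultiples b ≤ A := sup_le hLA (AddSubgroup.zmultiples_le_of_mem hbA)
  have e1 := AddSubgroup.relIndex_mul_relIndex L _ A le_sup_left hMA
  have e2 := AddSubgroup.relIndex_mul_relIndex L' _ A le_sup_left (hM ▸ hMA)
  rw [AddSubgroup.relIndex_sup_left] at e1 e2
  rw [← hM] at e2
  have hLA0 : L.relIndex A ≠ 0 := hind
  have hq0 : L.relIndex (AddSubgroup.zmultiples b) ≠ 0 := fun h => hLA0 (by rw [← e1, h, zero_mul])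
  have hM0 : (L ⊔ AddSubgroup.zmultiples b).relIndex A ≠ 0 :=
    fun h => hLA0 (by rw [← e1, h, mul_zero])
  show L'.relIndex A < L.relIndex A
  rw [← e1, ← e2]
  refine Nat.mul_lt_mul_of_pos_right ?_ (Nat.pos_of_ne_zero hM0)
  obtain ⟨q, hq, hqle, hqb⟩ := AddSubgroup.exists_nsmul_mem_of_relIndex_ne_zero hq0
    (AddSubgroup.mem_zmultiples b)
  refine lt_of_lt_of_le ?_ hqle
  obtain ⟨w, hw, hwint, hwb⟩ := mem_closure_iff.1 hqb.1
  have hwy : w = (q : ℝ) • y := hli _ _ hw (Finsupp.support_smul.trans hy) (by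
    rw [hwb, map_smul, Nat.cast_smul_eq_nsmul])
  obtain ⟨m, hm⟩ := hwint i
  have hmy : (m : ℝ) = q * y i := by rw [← hm, hwy]; simp
  have hqR : (0 : ℝ) < q := by exact_mod_cast hq
  have hm0 : 0 < m := by
    have : (0 : ℝ) < m := hmy ▸ mul_pos hqR h0
    exact_mod_cast this
  have hmq : m < q := by
    have : (m : ℝ) < q := by
      rw [hmy]
      exact mul_lt_of_lt_one_right hqR h1
    exact_mod_cast this
  have hmem : m • i ∈ L' := by
    have : m • i = q • b - bary (w.erase i) := by
      rw [← hwb, ← bary_erase_add w i, hm, Int.cast_smul_eq_zsmul, add_sub_cancel_left]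
    rw [this]
    refine sub_mem (nsmul_mem hbL' q) ?_
    have hsub : ((σ.erase i : Finset M) : Set M) ⊆ (insert b (σ.erase i) : Finset M) := by
      exact_mod_cast subset_insert _ _
    refine AddSubgroup.closure_mono hsub (mem_closure_iff.2 ⟨w.erase i, ?_, fun v => ?_, rfl⟩)
    · rw [Finsupp.support_erase]; exact erase_subset_erase _ hw
    · by_cases hv : v = i
      · exact ⟨0, by simp [hv]⟩
      · rw [Finsupp.erase_ne hv]; exact hwint v
  have := Nat.le_of_dvd (by omega) (relIndex_zmultiples_dvd hmem)
  omega

end Index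

section Join

variable {M : Type*}

theorem IsFan.of_subset [AddCommGroup M] [Module ℝ M] {K K' : Set (Finset M)} (hK : IsFan K)
    (h : K' ⊆ K) (hdown : ∀ s ∈ K', ∀ t ⊆ s, t ∈ K') : IsFan K' :=
  ⟨hdown, hK.inj.mono (show coeffs K' ⊆ coeffs K from fun _ hy => ⟨hy.1, h hy.2⟩)⟩

variable [DecidableEq M]

/-- The simplices in the boundary of the star of `f`, not counting those that contain `f`. -/
def bdry (T : Set (Finset M)) (f : Finset M) : Set (Finset M) := {t | t ∈ T ∧ ¬ f ⊆ t ∧ t ∪ f ∈ T}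

/-- The cone with apex `b` over a family of simplices. -/
def join (b : M) (X : Set (Finset M)) : Set (Finset M) := {A | A.erase b ∈ X}

theorem bdry_subset (T : Set (Finset M)) (f : Finset M) : bdry T f ⊆ T := fun _ h => h.1

theorem bdry_down {T : Set (Finset M)} (hT : ∀ s ∈ T, ∀ t ⊆ s, t ∈ T) (f : Finset M) :
    ∀ s ∈ bdry T f, ∀ t ⊆ s, t ∈ bdry T f := fun s ⟨h1, h2, h3⟩ t ht =>
  ⟨hT s h1 t ht, fun h => h2 (h.trans ht), hT _ h3 _ (union_subset_union_left ht)⟩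

theorem join_down {X : Set (Finset M)} (hX : ∀ s ∈ X, ∀ t ⊆ s, t ∈ X) (b : M) :
    ∀ s ∈ join b X, ∀ t ⊆ s, t ∈ join b X := fun _ hs _ ht => hX _ hs _ (erase_subset_erase b ht)

theorem finite_join {X : Set (Finset M)} (hX : X.Finite) (b : M) : (join b X).Finite := by
  refine (hX.union (hX.image (insert b))).subset fun s hs => ?_
  by_cases h : b ∈ s
  · exact Or.inr ⟨_, hs, insert_erase h⟩
  · exact Or.inl (erase_eq_of_notMem h ▸ hs)

variable [AddCommGroup M] [Module ℝ M]

theorem carrier_join {X : Set (Finset M)} (hX : ∀ s ∈ X, ∀ t ⊆ s, t ∈ X) (b : M) :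
    carrier (join b X) = {x | ∃ d ∈ carrier X, ∃ ε : ℝ, 0 ≤ ε ∧ d + ε • b = x} := by
  ext x
  constructor
  · rintro ⟨z, ⟨hz, hzs⟩, rfl⟩
    refine ⟨_, ⟨z.erase b, ⟨erase_nonneg hz b, ?_⟩, rfl⟩, z b, hz b, bary_erase_add z b⟩
    rw [Finsupp.support_erase]
    exact hzs
  · rintro ⟨_, ⟨y, ⟨hy, hys⟩, rfl⟩, ε, hε, rfl⟩
    refine ⟨y + Finsupp.single b ε, ⟨add_nonneg hy (by simpa using hε), hX _ hys _ ?_⟩, by simp⟩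
    refine (erase_subset_erase b Finsupp.support_add).trans fun v hv => ?_
    rw [mem_erase, mem_union] at hv
    rcases hv.2 with h | h
    · exact h
    · exact absurd (mem_singleton.1 (Finsupp.support_single_subset h)) hv.1

theorem IsFan.bary_notMem_coneOf {T : Set (Finset M)} (hT : IsFan T) {y : M →₀ ℝ}
    (hy : 0 ≤ y) (hyT : y.support ∈ T) {t : Finset M} (ht : t ∈ T) (h : ¬ y.support ⊆ t) :
    bary y ∉ coneOf t := fun hb => h (hT.support_subset_of_mem_coneOf ht ⟨hy, hyT⟩ hb)

theorem IsFan.bary_add_inj {T : Set (Finset M)} (hT : IsFan T) {y : M →₀ ℝ}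
    (hy : 0 ≤ y) {w w' : M →₀ ℝ} (hw : w ∈ coeffs (bdry T y.support))
    (hw' : w' ∈ coeffs (bdry T y.support)) {ε ε' : ℝ} (hε : 0 ≤ ε) (hε' : 0 ≤ ε')
    (h : bary w + ε • bary y = bary w' + ε' • bary y) : ε = ε' := by
  have key : ∀ {u u' : M →₀ ℝ} {δ δ' : ℝ}, u ∈ coeffs (bdry T y.support) →
      u' ∈ coeffs (bdry T y.support) → 0 ≤ δ → 0 ≤ δ' →
      bary u + δ • bary y = bary u' + δ' • bary y → δ' ≤ δ := by
    intro u u' δ δ' hu hu' hδ hδ' h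
    by_contra! hlt
    have hin : ∀ {v : M →₀ ℝ} {r : ℝ}, v ∈ coeffs (bdry T y.support) → 0 ≤ r →
        v + r • y ∈ coeffs T := fun hv hr => ⟨add_nonneg hv.1 (smul_nonneg hr hy),
      hT.down _ hv.2.2.2 _ (Finsupp.support_add.trans
        (union_subset_union_right Finsupp.support_smul))⟩
    have e : u + δ • y = u' + δ' • y := hT.inj (hin hu hδ) (hin hu' hδ') (by simpa using h)
    refine hu.2.2.1 fun v hv => Finsupp.mem_support_iff.2 ?_
    have e1 := DFunLike.congr_fun e v
    have h1 := pos_of_mem_support hy hv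
    have h2 : 0 ≤ u' v := hu'.1 v
    simp only [Finsupp.coe_add, Finsupp.coe_smul, Pi.add_apply, Pi.smul_apply, smul_eq_mul] at e1
    nlinarith [mul_pos (sub_pos.2 hlt) h1]
  exact le_antisymm (key hw' hw hε' hε h.symm) (key hw hw' hε hε' h)

/-- The cone over a subdivision of the boundary of a star is a fan. -/
theorem IsFan.join {T : Set (Finset M)} (hT : IsFan T) {y : M →₀ ℝ} (hy : 0 ≤ y)
    {X : Set (Finset M)} (hX : IsFan X) (hcar : carrier X = carrier (bdry T y.support)) :
    IsFan (join (bary y) X) := by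
  refine ⟨join_down hX.down _, ?_⟩
  intro z ⟨hz, hzs⟩ z' ⟨hz', hzs'⟩ h
  have hmem : ∀ {u : M →₀ ℝ}, 0 ≤ u → u.support ∈ EdgewiseFan.join (bary y) X →
      u.erase (bary y) ∈ coeffs X := fun hu hus =>
    ⟨erase_nonneg hu _, by rw [Finsupp.support_erase]; exact hus⟩
  have hc : ∀ {u : M →₀ ℝ}, u ∈ coeffs X → ∃ w ∈ coeffs (bdry T y.support), bary w = bary u :=
    fun {u} hu => by
      have : bary u ∈ carrier X := ⟨u, hu, rfl⟩
      rwa [hcar] at this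
  rw [← bary_erase_add z (bary y), ← bary_erase_add z' (bary y)] at h
  obtain ⟨w, hw, hwz⟩ := hc (hmem hz hzs)
  obtain ⟨w', hw', hwz'⟩ := hc (hmem hz' hzs')
  have he : z (bary y) = z' (bary y) := hT.bary_add_inj hy hw hw' (hz _) (hz' _)
    (by rw [hwz, hwz', h])
  rw [he] at h
  rw [← Finsupp.erase_add_single (bary y) z, ← Finsupp.erase_add_single (bary y) z', he]
  congr 1
  exact hX.inj (hmem hz hzs) (hmem hz' hzs') (add_right_cancel h)

/-- Every point in the star of `y.support` lies on a segment from the ray of `bary y` to the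
boundary of the star. -/
theorem exists_mem_bdry {T : Set (Finset M)} (hT : IsFan T) {y x : M →₀ ℝ} (hy : 0 ≤ y)
    (hne : y.support.Nonempty) (hx : x ∈ coeffs T) (hyx : y.support ⊆ x.support) :
    ∃ w ∈ coeffs (bdry T y.support), ∃ ε : ℝ, 0 ≤ ε ∧ bary w + ε • bary y = bary x := by
  obtain ⟨i, hi, hmin⟩ := exists_min_image y.support (fun v => x v / y v) hne
  have hyi := pos_of_mem_support hy hi
  set ε := x i / y i with hε
  have hε0 : 0 ≤ ε := div_nonneg (hx.1 i) hyi.le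
  have hsub : (x - ε • y).support ⊆ x.support := Finsupp.support_sub.trans
    (union_subset subset_rfl (Finsupp.support_smul.trans hyx))
  refine ⟨x - ε • y, ⟨fun v => ?_, hT.down _ hx.2 _ hsub, fun h => ?_, hT.down _ hx.2 _
    (union_subset hsub hyx)⟩, ε, hε0, by simp⟩
  · by_cases hv : v ∈ y.support
    · have h1 := hmin v hv
      rw [le_div_iff₀ (pos_of_mem_support hy hv)] at h1
      simpa using h1
    · simpa [Finsupp.notMem_support_iff.1 hv] using hx.1 v
  · refine Finsupp.mem_support_iff.1 (h hi) ?_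
    simp [hε, hyi.ne']

end Join

section Lattice

variable {M : Type*} [AddCommGroup M] [Module ℝ M]

/-- The points of `Λ` whose height is a multiple of `H`. -/
def level (Λ : AddSubgroup M) (ht : M →ₗ[ℝ] ℝ) (H : ℕ) : AddSubgroup M where
  carrier := {x | x ∈ Λ ∧ ∃ k : ℤ, ht x = k * H}
  zero_mem' := ⟨zero_mem _, 0, by simp⟩
  add_mem' := by
    rintro a b ⟨ha, k, hk⟩ ⟨hb, l, hl⟩
    exact ⟨add_mem ha hb, k + l, by rw [map_add, hk, hl]; push_cast; ring⟩
  neg_mem' := by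
    rintro a ⟨ha, k, hk⟩
    exact ⟨neg_mem ha, -k, by rw [map_neg, hk]; push_cast; ring⟩

theorem mem_level {Λ : AddSubgroup M} {ht : M →ₗ[ℝ] ℝ} {H : ℕ} {x : M} :
    x ∈ level Λ ht H ↔ x ∈ Λ ∧ ∃ k : ℤ, ht x = k * H := Iff.rfl

theorem level_mul_le (Λ : AddSubgroup M) (ht : M →ₗ[ℝ] ℝ) (c H : ℕ) :
    level Λ ht (c * H) ≤ level Λ ht H := by
  rintro x ⟨hx, k, hk⟩
  exact ⟨hx, k * c, by rw [hk]; push_cast; ring⟩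

theorem level_le (Λ : AddSubgroup M) (ht : M →ₗ[ℝ] ℝ) (H : ℕ) : level Λ ht H ≤ Λ :=
  fun _ h => (mem_level.1 h).1

/-- The members of `s` are points of `Λ` of height `H`. -/
def AtLevel (Λ : AddSubgroup M) (ht : M →ₗ[ℝ] ℝ) (H : ℕ) (s : Finset M) : Prop :=
  ∀ v ∈ s, v ∈ Λ ∧ ht v = H

theorem AtLevel.mem_level {Λ : AddSubgroup M} {ht : M →ₗ[ℝ] ℝ} {H : ℕ} {s : Finset M}
    (h : AtLevel Λ ht H s) : ∀ v ∈ s, v ∈ level Λ ht H := fun v hv =>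
  ⟨(h v hv).1, 1, by rw [(h v hv).2]; simp⟩

variable [LinearOrder M]

theorem map_bary_of_const (ht : M →ₗ[ℝ] ℝ) {s : Finset M} {r : ℝ} (hs : ∀ v ∈ s, ht v = r)
    {y : M →₀ ℝ} (hy : y.support ⊆ s) : ht (bary y) = total y * r := by
  rw [bary_eq_sum hy, map_sum, linearCombination_eq_sum _ hy, sum_mul]
  refine sum_congr rfl fun v hv => ?_
  rw [map_smul, hs v hv]; simp

theorem EdgewiseFace.atLevel {Λ : AddSubgroup M} {ht : M →ₗ[ℝ] ℝ} {H c : ℕ} {t A : Finset M}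
    (hA : EdgewiseFace c t A) (h : AtLevel Λ ht H t) : AtLevel Λ ht (c * H) A := by
  obtain ⟨V, h1, h2, -⟩ := hA
  intro p hp
  rw [← h1 p hp]
  refine ⟨sum_mem fun l hl => (h _ (h2 p hp l (mem_range.1 hl))).1, ?_⟩
  rw [map_sum, sum_congr rfl fun l hl => (h _ (h2 p hp l (mem_range.1 hl))).2]
  simp

theorem EdgewiseFace.span_le {c : ℕ} {t A : Finset M} (hA : EdgewiseFace c t A) :
    Submodule.span ℝ (A : Set M) ≤ Submodule.span ℝ (t : Set M) :=
  Submodule.span_le.2 fun _ hp => coneOf_subset_span (hA.mem_coneOf hp)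

variable [IsOrderedAddMonoid M]

theorem IsFan.mem_closure_of_ht {K : Set (Finset M)} (hK : IsFan K) {c : ℕ} (hc : 0 < c)
    {t A : Finset M} (htK : t ∈ K) (hA : EdgewiseFace c t A) {ht : M →ₗ[ℝ] ℝ} {H : ℕ}
    (hH : 0 < H) (hlev : ∀ v ∈ t, ht v = H) {x : M} (hx : x ∈ AddSubgroup.closure (t : Set M))
    (hxA : x ∈ Submodule.span ℝ (A : Set M)) (hht : ∃ k : ℤ, ht x = k * (c * H : ℕ)) :
    x ∈ AddSubgroup.closure (A : Set M) := by
  obtain ⟨n, hn, hnint, rfl⟩ := mem_closure_iff.1 hx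
  refine hK.mem_closure_of_edgewiseFace hc htK hA hn hnint ?_ hxA
  obtain ⟨k, hk⟩ := hht
  refine ⟨k, ?_⟩
  rw [map_bary_of_const ht hlev hn] at hk
  have : (H : ℝ) ≠ 0 := by exact_mod_cast hH.ne'
  apply mul_right_cancel₀ this
  rw [hk]; push_cast; ring

theorem IsFan.ind_edgewiseFace_le {K : Set (Finset M)} (hK : IsFan K) {c : ℕ} (hc : 0 < c)
    {t A : Finset M} (htK : t ∈ K) (hA : EdgewiseFace c t A) {Λ : AddSubgroup M}
    (hΛ : BoxFinite Λ) {ht : M →ₗ[ℝ] ℝ} {H : ℕ} (hH : 0 < H) (hlev : AtLevel Λ ht H t) :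
    ind (level Λ ht (c * H)) A ≤ ind (level Λ ht H) t := by
  refine relIndex_le_relIndex (inf_le_inf (level_mul_le _ _ _ _) fun x hx => hA.span_le hx) ?_
    (ind_ne_zero (hΛ.mono (level_le _ _ _)) hlev.mem_level)
  rintro x ⟨hx, ⟨-, hx'⟩, hxA⟩
  exact hK.mem_closure_of_ht hc htK hA hH (fun v hv => (hlev v hv).2) hx hxA hx'

end Lattice

section Star

variable {M : Type*} [AddCommGroup M] [Module ℝ M] [LinearOrder M]

/-- The part of the refined star over `y.support`. -/
def starPiece (T : Set (Finset M)) (y : M →₀ ℝ) (a h : ℕ) : Set (Finset M) :=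
  edgewise a (join (bary y) (edgewise h (bdry T y.support)))

/-- Members of the refined star whose cone meets a simplex not containing `y.support`. -/
theorem IsFan.edgewiseFace_of_sum_mem [IsOrderedAddMonoid M] {T : Set (Finset M)} (hT : IsFan T)
    {y : M →₀ ℝ} (hy : 0 ≤ y) (hyT : y.support ∈ T) {a h : ℕ} {t B A : Finset M}
    (ht : t ∈ bdry T y.support) (hB : EdgewiseFace h t (B.erase (bary y)))
    (hA : EdgewiseFace a B A) (hg : ∀ p ∈ A, ∃ g ∈ T, ¬ y.support ⊆ g ∧ p ∈ coneOf g) :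
    EdgewiseFace (h * a) t A := by
  obtain ⟨V, h1, h2, h3, h4⟩ := hA
  have hBt : ∀ v ∈ B, v ∈ coneOf (t ∪ y.support) := fun v hv => by
    by_cases hvb : v = bary y
    · rw [hvb]
      exact ⟨y, hy, subset_union_right, rfl⟩
    · exact coneOf_mono subset_union_left (hB.mem_coneOf (mem_erase.2 ⟨hvb, hv⟩))
  have hV : ∀ p ∈ A, ∀ g ∈ T, p ∈ coneOf g → ∀ l < a, V p l ∈ coneOf g := by
    intro p hp g hgT hpg l hl
    refine hT.mem_coneOf_of_sum ht.2.2 hgT (s := range a) (f := V p)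
      (fun l hl => hBt _ (h2 p hp l (mem_range.1 hl))) ?_ l (mem_range.2 hl)
    rwa [h1 p hp]
  have hA' : EdgewiseFace a (B.erase (bary y)) A := by
    refine ⟨V, h1, fun p hp l hl => mem_erase.2 ⟨fun h => ?_, h2 p hp l hl⟩, h3, h4⟩
    obtain ⟨g, hgT, hyg, hpg⟩ := hg p hp
    exact hT.bary_notMem_coneOf hy hyT hgT hyg (h ▸ hV p hp g hgT hpg l hl)
  exact hA'.trans hB

/-- A system of lattice points `bary y` in the relative interiors of faces `y.support` of `T` with
pairwise disjoint open stars. The height of `bary y` is `h y * H`, and `c` is a common multiple of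
the numbers `h y`. -/
structure StarSystem (T : Set (Finset M)) (Λ : AddSubgroup M) (ht : M →ₗ[ℝ] ℝ) (H : ℕ)
    (Φ : Set (M →₀ ℝ)) (h : (M →₀ ℝ) → ℕ) (c : ℕ) : Prop where
  fan : IsFan T
  fin : T.Finite
  level : ∀ t ∈ T, AtLevel Λ ht H t
  hpos : 0 < H
  cpos : 0 < c
  finite : Φ.Finite
  mem : ∀ y ∈ Φ, y.support ∈ T
  nonneg : ∀ y ∈ Φ, 0 ≤ y
  lt_one : ∀ y ∈ Φ, ∀ v, y v < 1
  nonempty : ∀ y ∈ Φ, y.support.Nonempty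
  lat : ∀ y ∈ Φ, bary y ∈ Λ
  height : ∀ y ∈ Φ, ht (bary y) = h y * H
  pos : ∀ y ∈ Φ, 0 < h y
  dvd : ∀ y ∈ Φ, h y ∣ c
  disj : ∀ y ∈ Φ, ∀ y' ∈ Φ, ∀ s ∈ T, y.support ⊆ s → y'.support ⊆ s → y = y'

/-- The simplices that are not in the stars. -/
def outside (T : Set (Finset M)) (Φ : Set (M →₀ ℝ)) : Set (Finset M) :=
  {t | t ∈ T ∧ ∀ y ∈ Φ, ¬ y.support ⊆ t}

/-- The `c`-fold edgewise subdivision away from the stars, together with the refined stars. -/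
def starRefine (T : Set (Finset M)) (Φ : Set (M →₀ ℝ)) (h : (M →₀ ℝ) → ℕ) (c : ℕ) :
    Set (Finset M) :=
  {s | s ∈ edgewise c (outside T Φ) ∨ ∃ y ∈ Φ, s ∈ starPiece T y (c / h y) (h y)}

namespace StarSystem

variable {T : Set (Finset M)} {Λ : AddSubgroup M} {ht : M →ₗ[ℝ] ℝ} {H : ℕ} {Φ : Set (M →₀ ℝ)}
  {h : (M →₀ ℝ) → ℕ} {c : ℕ}

theorem div_pos (S : StarSystem T Λ ht H Φ h c) {y : M →₀ ℝ} (hy : y ∈ Φ) : 0 < c / h y :=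
  Nat.div_pos (Nat.le_of_dvd S.cpos (S.dvd y hy)) (S.pos y hy)

theorem mul_div (S : StarSystem T Λ ht H Φ h c) {y : M →₀ ℝ} (hy : y ∈ Φ) :
    h y * (c / h y) = c := Nat.mul_div_cancel' (S.dvd y hy)

theorem outside_down (S : StarSystem T Λ ht H Φ h c) :
    ∀ s ∈ outside T Φ, ∀ t ⊆ s, t ∈ outside T Φ := fun _ hs _ ht =>
  ⟨S.fan.down _ hs.1 _ ht, fun y hy h => hs.2 y hy (h.trans ht)⟩

theorem outside_fan (S : StarSystem T Λ ht H Φ h c) : IsFan (outside T Φ) :=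
  S.fan.of_subset (fun _ h => h.1) S.outside_down

theorem bdry_fan (S : StarSystem T Λ ht H Φ h c) (y : M →₀ ℝ) : IsFan (bdry T y.support) :=
  S.fan.of_subset (bdry_subset _ _) (bdry_down S.fan.down _)

end StarSystem

end Star

section StarRefine

variable {M : Type*} [AddCommGroup M] [Module ℝ M] [LinearOrder M] [IsOrderedAddMonoid M]

theorem IsFan.mem_coneOf_of_bary {T : Set (Finset M)} (hT : IsFan T) {t g : Finset M} (ht : t ∈ T)
    (hg : g ∈ T) {z : M →₀ ℝ} (hz : 0 ≤ z) (hzt : ∀ p ∈ z.support, p ∈ coneOf t)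
    (h : bary z ∈ coneOf g) : ∀ p ∈ z.support, p ∈ coneOf g := by
  intro p hp
  rw [bary_eq_sum subset_rfl] at h
  have h1 := hT.mem_coneOf_of_sum ht hg (fun p hp => smul_mem_coneOf (hz p) (hzt p hp)) h p hp
  have h2 := smul_mem_coneOf (inv_nonneg.2 (hz p)) h1
  rwa [smul_smul, inv_mul_cancel₀ (Finsupp.mem_support_iff.1 hp), one_smul] at h2

theorem carrier_mono {K K' : Set (Finset M)} (h : K ⊆ K') : carrier K ⊆ carrier K' :=
  Set.image_mono fun _ hx => ⟨hx.1, h hx.2⟩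

theorem mem_coneOf_union_of_erase {y : M →₀ ℝ} (hy : 0 ≤ y) {a h : ℕ} {t B A : Finset M}
    (hB : EdgewiseFace h t (B.erase (bary y))) (hA : EdgewiseFace a B A) :
    ∀ p ∈ A, p ∈ coneOf (t ∪ y.support) := by
  intro p hp
  refine coneOf_trans (fun v hv => ?_) (hA.mem_coneOf hp)
  by_cases hvb : v = bary y
  · rw [hvb]
    exact ⟨y, hy, subset_union_right, rfl⟩
  · exact coneOf_mono subset_union_left (hB.mem_coneOf (mem_erase.2 ⟨hvb, hv⟩))

namespace StarSystem

variable {T : Set (Finset M)} {Λ : AddSubgroup M} {ht : M →ₗ[ℝ] ℝ} {H : ℕ} {Φ : Set (M →₀ ℝ)}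
  {h : (M →₀ ℝ) → ℕ} {c : ℕ}

theorem starRefine_finite (S : StarSystem T Λ ht H Φ h c) : (starRefine T Φ h c).Finite := by
  have h1 : outside T Φ ⊆ T := fun _ h => h.1
  refine ((finite_edgewise c (S.fin.subset h1)).union (S.finite.biUnion
    (t := fun y => starPiece T y (c / h y) (h y)) fun y _ => finite_edgewise _ (finite_join
      (finite_edgewise _ (S.fin.subset (bdry_subset _ _))) _))).subset ?_
  rintro s (hs | ⟨y, hy, hs⟩)
  · exact Or.inl hs
  · exact Or.inr (Set.mem_biUnion hy hs)

theorem starRefine_atLevel (S : StarSystem T Λ ht H Φ h c) :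
    ∀ s ∈ starRefine T Φ h c, AtLevel Λ ht (c * H) s := by
  rintro s (⟨t, h1, h2⟩ | ⟨y, hy, B, ⟨t, h1, h2⟩, h3⟩)
  · exact h2.atLevel (S.level t h1.1)
  · rw [← S.mul_div hy, mul_comm (h y), mul_assoc]
    refine h3.atLevel fun v hv => ?_
    by_cases hvb : v = bary y
    · rw [hvb, S.height y hy]
      exact ⟨S.lat y hy, by push_cast; rfl⟩
    · exact h2.atLevel (S.level t h1.1) v (mem_erase.2 ⟨hvb, hv⟩)

variable [TopologicalSpace M] [IsTopologicalAddGroup M] [ContinuousSMul ℝ M] [T2Space M]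

theorem join_fan (S : StarSystem T Λ ht H Φ h c) {y : M →₀ ℝ} (hy : y ∈ Φ) :
    IsFan (join (bary y) (edgewise (h y) (bdry T y.support))) :=
  S.fan.join (S.nonneg y hy) ((S.bdry_fan y).edgewise (S.pos y hy))
    ((S.bdry_fan y).carrier_edgewise (S.pos y hy))

theorem piece_fan (S : StarSystem T Λ ht H Φ h c) {y : M →₀ ℝ} (hy : y ∈ Φ) :
    IsFan (starPiece T y (c / h y) (h y)) := (S.join_fan hy).edgewise (S.div_pos hy)

theorem carrier_starPiece (S : StarSystem T Λ ht H Φ h c) {y : M →₀ ℝ} (hy : y ∈ Φ) :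
    carrier (starPiece T y (c / h y) (h y)) =
      {x | ∃ d ∈ carrier (bdry T y.support), ∃ ε : ℝ, 0 ≤ ε ∧ d + ε • bary y = x} := by
  rw [starPiece, (S.join_fan hy).carrier_edgewise (S.div_pos hy),
    carrier_join ((S.bdry_fan y).edgewise (S.pos y hy)).down,
    (S.bdry_fan y).carrier_edgewise (S.pos y hy)]

theorem exists_coeffs_of_outside (S : StarSystem T Λ ht H Φ h c) {x : M}
    (hx : x ∈ carrier (edgewise c (outside T Φ))) :
    ∃ w ∈ coeffs T, bary w = x ∧ ∀ y ∈ Φ, ¬ y.support ⊆ w.support := by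
  rw [S.outside_fan.carrier_edgewise S.cpos] at hx
  obtain ⟨w, hw, rfl⟩ := hx
  exact ⟨w, ⟨hw.1, hw.2.1⟩, rfl, hw.2.2⟩

theorem exists_coeffs_of_starPiece (S : StarSystem T Λ ht H Φ h c) {y : M →₀ ℝ} (hy : y ∈ Φ)
    {x : M} (hx : x ∈ carrier (starPiece T y (c / h y) (h y))) :
    ∃ w ∈ coeffs T, bary w = x ∧ w.support ∪ y.support ∈ T := by
  rw [S.carrier_starPiece hy] at hx
  obtain ⟨_, ⟨w, hw, rfl⟩, ε, hε, rfl⟩ := hx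
  have hsub : (w + ε • y).support ⊆ w.support ∪ y.support :=
    Finsupp.support_add.trans (union_subset_union_right Finsupp.support_smul)
  refine ⟨w + ε • y, ⟨add_nonneg hw.1 (smul_nonneg hε (S.nonneg y hy)),
    S.fan.down _ hw.2.2.2 _ hsub⟩, by simp, S.fan.down _ hw.2.2.2 _
    (union_subset hsub subset_union_right)⟩

theorem carrier_starRefine (S : StarSystem T Λ ht H Φ h c) :
    carrier (starRefine T Φ h c) = carrier T := by
  apply subset_antisymm
  · rintro _ ⟨z, ⟨hz, hzs | ⟨y, hy, hzs⟩⟩, rfl⟩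
    · obtain ⟨w, hw, hwz, -⟩ := S.exists_coeffs_of_outside ⟨z, ⟨hz, hzs⟩, rfl⟩
      exact ⟨w, hw, hwz⟩
    · obtain ⟨w, hw, hwz, -⟩ := S.exists_coeffs_of_starPiece hy ⟨z, ⟨hz, hzs⟩, rfl⟩
      exact ⟨w, hw, hwz⟩
  · rintro _ ⟨x, hx, rfl⟩
    by_cases hyx : ∃ y ∈ Φ, y.support ⊆ x.support
    · obtain ⟨y, hy, hyx⟩ := hyx
      obtain ⟨w, hw, ε, hε, hwx⟩ := exists_mem_bdry S.fan (S.nonneg y hy) (S.nonempty y hy) hx hyx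
      have : bary x ∈ carrier (starPiece T y (c / h y) (h y)) := by
        rw [S.carrier_starPiece hy]
        exact ⟨_, ⟨w, hw, rfl⟩, ε, hε, hwx⟩
      exact carrier_mono (fun s hs => Or.inr ⟨y, hy, hs⟩) this
    · push Not at hyx
      have : bary x ∈ carrier (edgewise c (outside T Φ)) := by
        rw [S.outside_fan.carrier_edgewise S.cpos]
        exact ⟨x, ⟨hx.1, hx.2, hyx⟩, rfl⟩
      exact carrier_mono (fun s hs => Or.inl hs) this

theorem starRefine_fan (S : StarSystem T Λ ht H Φ h c) : IsFan (starRefine T Φ h c) := by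
  refine ⟨?_, ?_⟩
  · rintro s (hs | ⟨y, hy, hs⟩) t hts
    · exact Or.inl ((S.outside_fan.edgewise S.cpos).down s hs t hts)
    · exact Or.inr ⟨y, hy, (S.piece_fan hy).down s hs t hts⟩
  intro z hz z' hz' hzz
  obtain ⟨x, hx, hxz⟩ : ∃ x ∈ coeffs T, bary x = bary z := by
    have : bary z ∈ carrier (starRefine T Φ h c) := ⟨z, hz, rfl⟩
    rwa [S.carrier_starRefine] at this
  by_cases hyx : ∃ y ∈ Φ, y.support ⊆ x.support
  · obtain ⟨y, hy, hyx⟩ := hyx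
    have key : ∀ u ∈ coeffs (starRefine T Φ h c), bary u = bary x →
        u ∈ coeffs (starPiece T y (c / h y) (h y)) := by
      rintro u ⟨hu, hus | ⟨y', hy', hus⟩⟩ hux
      · obtain ⟨w, hw, hwu, hwΦ⟩ := S.exists_coeffs_of_outside ⟨u, ⟨hu, hus⟩, rfl⟩
        exact absurd hyx (S.fan.inj hw hx (hwu.trans hux) ▸ hwΦ y hy)
      · obtain ⟨w, hw, hwu, hwT⟩ := S.exists_coeffs_of_starPiece hy' ⟨u, ⟨hu, hus⟩, rfl⟩
        rw [S.fan.inj hw hx (hwu.trans hux)] at hwT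
        rw [S.disj y hy y' hy' _ hwT (hyx.trans subset_union_left) subset_union_right]
        exact ⟨hu, hus⟩
    exact (S.piece_fan hy).inj (key z hz hxz.symm) (key z' hz' (hxz.trans hzz).symm) hzz
  · push Not at hyx
    have key : ∀ u ∈ coeffs (starRefine T Φ h c), bary u = bary x →
        u ∈ coeffs (EdgewiseFan.edgewise c T) := by
      rintro u ⟨hu, hus | ⟨y, hy, B, ⟨t, ht, hB⟩, hA⟩⟩ hux
      · exact ⟨hu, edgewise_mono (fun _ h => h.1) hus⟩
      · refine ⟨hu, t, ht.1, ?_⟩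
        rw [← S.mul_div hy]
        refine (S.fan.edgewiseFace_of_sum_mem (S.nonneg y hy) (S.mem y hy) ht hB hA
          fun p hp => ⟨x.support, hx.2, hyx y hy, ?_⟩)
        refine S.fan.mem_coneOf_of_bary ht.2.2 hx.2 hu
          (mem_coneOf_union_of_erase (S.nonneg y hy) hB hA) ?_ p hp
        rw [hux]
        exact ⟨x, hx.1, subset_rfl, rfl⟩
    exact (S.fan.edgewise S.cpos).inj (key z hz hxz.symm) (key z' hz' (hxz.trans hzz).symm) hzz

theorem ind_outside_le (S : StarSystem T Λ ht H Φ h c) (hΛ : BoxFinite Λ) {t s : Finset M}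
    (htT : t ∈ T) (hs : EdgewiseFace c t s) :
    ind (EdgewiseFan.level Λ ht (c * H)) s ≤ ind (EdgewiseFan.level Λ ht H) t :=
  S.fan.ind_edgewiseFace_le S.cpos htT hs hΛ S.hpos (S.level t htT)

/-- The index drops on the refined stars. -/
theorem ind_starPiece_lt (S : StarSystem T Λ ht H Φ h c) (hΛ : BoxFinite Λ) {y : M →₀ ℝ}
    (hy : y ∈ Φ) {t B A : Finset M} (htT : t ∈ bdry T y.support)
    (hB : EdgewiseFace (h y) t (B.erase (bary y))) (hA : EdgewiseFace (c / h y) B A) :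
    ind (EdgewiseFan.level Λ ht (c * H)) A <
      ind (EdgewiseFan.level Λ ht H) (t ∪ y.support) := by
  obtain ⟨i, hif, hit⟩ := not_subset.1 htT.2.1
  set σ := t ∪ y.support with hσ
  have hσT : σ ∈ T := htT.2.2
  set b := bary y with hb
  have hΛ' : BoxFinite (EdgewiseFan.level Λ ht H) := hΛ.mono (level_le _ _ _)
  have hσΛ := (S.level σ hσT).mem_level
  have hiσ : i ∈ σ := mem_union_right _ hif
  have hyi := pos_of_mem_support (S.nonneg y hy) hif
  have hyσ : y.support ⊆ σ := subset_union_right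
  have htσ : t ⊆ σ := subset_union_left
  have hli := fun (x y : M →₀ ℝ) hx hy h => S.fan.ext_of_subset hσT (x := x) (y := y) hx hy h
  have hbΛ : b ∈ EdgewiseFan.level Λ ht H :=
    ⟨S.lat y hy, h y, by rw [S.height y hy]; push_cast; rfl⟩
  refine lt_of_le_of_lt ?_ (relIndex_insert_erase_lt hli hσΛ (ind_ne_zero hΛ' hσΛ) hyσ hbΛ hiσ hyi
    (S.lt_one y hy i))
  have hBσ : ∀ v ∈ B, v ∈ Submodule.span ℝ (σ : Set M) := fun v hv => by
    by_cases hvb : v = b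
    · exact mem_span_iff.2 ⟨y, hyσ, by rw [hvb]⟩
    · exact Submodule.span_mono (by exact_mod_cast htσ)
        (hB.span_le (Submodule.subset_span (mem_erase.2 ⟨hvb, hv⟩)))
  have hAσ : Submodule.span ℝ (A : Set M) ≤ Submodule.span ℝ (σ : Set M) :=
    hA.span_le.trans (Submodule.span_le.2 hBσ)
  have hspan : Submodule.span ℝ ((insert b (σ.erase i) : Finset M) : Set M) =
      Submodule.span ℝ (σ : Set M) := by
    apply le_antisymm
    · refine Submodule.span_le.2 fun v hv => ?_
      rcases mem_insert.1 hv with rfl | hv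
      · exact mem_span_iff.2 ⟨y, hyσ, rfl⟩
      · exact Submodule.subset_span (mem_of_mem_erase hv)
    · refine Submodule.span_le.2 fun v hv => ?_
      have hE : ∀ w ∈ σ.erase i,
          w ∈ Submodule.span ℝ ((insert b (σ.erase i) : Finset M) : Set M) := fun w hw =>
        Submodule.subset_span (mem_insert_of_mem hw)
      by_cases hvi : v = i
      · have h1 := bary_erase_add y i
        have h2 : bary (y.erase i) ∈
            Submodule.span ℝ ((insert b (σ.erase i) : Finset M) : Set M) := by
          refine mem_span_iff.2 ⟨_, ?_, rfl⟩
          rw [Finsupp.support_erase]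
          exact (erase_subset_erase i hyσ).trans (subset_insert _ _)
        have h3 : i = (y i)⁻¹ • (b - bary (y.erase i)) := by
          rw [hb, ← h1, add_sub_cancel_left, smul_smul, inv_mul_cancel₀ hyi.ne', one_smul]
        have h4 : (y i)⁻¹ • (b - bary (y.erase i)) ∈
            Submodule.span ℝ ((insert b (σ.erase i) : Finset M) : Set M) :=
          Submodule.smul_mem _ _ (Submodule.sub_mem _
            (Submodule.subset_span (mem_insert_self _ _)) h2)
        rw [← h3] at h4
        exact hvi ▸ h4
      · exact hE v (mem_erase.2 ⟨hvi, hv⟩)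
  refine relIndex_le_relIndex (inf_le_inf (level_mul_le _ _ _ _) fun x hx => hAσ hx) ?_ ?_
  swap
  · have := ind_ne_zero hΛ' (s := insert b (σ.erase i)) fun v hv => by
      rcases mem_insert.1 hv with rfl | hv
      · exact hbΛ
      · exact hσΛ v (mem_of_mem_erase hv)
    rwa [ind, hspan] at this
  rintro x ⟨hx, ⟨-, k, hk⟩, hxA⟩
  have hBB : (insert b B).erase b = B.erase b := by
    ext v; by_cases hvb : v = b <;> simp [hvb]
  have hB'T : insert b B ∈ join (bary y) (EdgewiseFan.edgewise (h y) (bdry T y.support)) := by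
    refine ⟨t, htT, ?_⟩
    rwa [hBB]
  have hA' := hA.mono (subset_insert b B)
  have hB'lev : AtLevel Λ ht (h y * H) (insert b B) := fun v hv => by
    by_cases hvb : v = b
    · rw [hvb, S.height y hy]
      exact ⟨S.lat y hy, by push_cast; rfl⟩
    · exact hB.atLevel (S.level t htT.1) v (mem_erase.2 ⟨hvb, (mem_insert.1 hv).resolve_left hvb⟩)
  refine (S.join_fan hy).mem_closure_of_ht (S.div_pos hy) hB'T hA'
    (Nat.mul_pos (S.pos y hy) S.hpos) (fun v hv => (hB'lev v hv).2) ?_ hxA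
    ⟨k, by rw [hk, ← mul_assoc, mul_comm (c / h y), S.mul_div hy]⟩
  replace hx : x ∈ AddSubgroup.closure ((insert b (σ.erase i) : Finset M) : Set M) := hx
  replace hxA : x ∈ Submodule.span ℝ (A : Set M) := hxA
  rw [coe_insert, Set.insert_eq, AddSubgroup.closure_union, AddSubgroup.mem_sup] at hx
  obtain ⟨_, hβ, e, he, rfl⟩ := hx
  rw [AddSubgroup.mem_closure_singleton] at hβ
  obtain ⟨β, rfl⟩ := hβ
  have hxB := hA'.span_le hxA
  rw [← insert_erase (mem_insert_self b B), hBB, coe_insert, Submodule.mem_span_insert] at hxB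
  obtain ⟨r, z, hz, hrz⟩ := hxB
  obtain ⟨ne, hne, hnei, rfl⟩ := mem_closure_iff.1 he
  obtain ⟨nz, hnz, hnzz⟩ := mem_span_iff.1 (hB.span_le hz)
  subst hnzz
  have heq : (β : ℝ) • y + ne = r • y + nz := by
    refine hli _ _ ?_ ?_ ?_
    · exact Finsupp.support_add.trans (union_subset (Finsupp.support_smul.trans hyσ)
        (hne.trans (erase_subset _ _)))
    · exact Finsupp.support_add.trans (union_subset (Finsupp.support_smul.trans hyσ)
        (hnz.trans htσ))
    · rw [map_add, map_add, map_smul, map_smul, ← hb, ← hrz, Int.cast_smul_eq_zsmul]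
  have hβr : (β : ℝ) = r := by
    have h1 := DFunLike.congr_fun heq i
    have h2 : ne i = 0 := Finsupp.notMem_support_iff.1 fun h => by simpa using hne h
    have h3 : nz i = 0 := Finsupp.notMem_support_iff.1 fun h => hit (hnz h)
    simpa [h2, h3, hyi.ne'] using h1
  rw [hβr, add_right_inj] at heq
  subst heq
  have hbB : b ∈ AddSubgroup.closure ((insert b B : Finset M) : Set M) :=
    AddSubgroup.subset_closure (mem_insert_self _ _)
  refine add_mem (zsmul_mem hbB β) ?_
  refine AddSubgroup.closure_mono (h := ((B.erase b : Finset M) : Set M)) (by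
    exact_mod_cast (erase_subset b B).trans (subset_insert b B)) ?_
  refine (S.bdry_fan y).mem_closure_of_ht (S.pos y hy) htT hB S.hpos
    (fun v hv => (S.level t htT.1 v hv).2) (mem_closure_iff.2 ⟨ne, hnz, hnei, rfl⟩) hz ?_
  refine ⟨k * (c / h y : ℕ) - β, ?_⟩
  have h1 : ht (bary ne) = k * (c * H : ℕ) - β * (h y * H) := by
    rw [← hk, map_add, map_zsmul, S.height y hy]; simp
  have h2 : (c : ℝ) = h y * (c / h y : ℕ) := by exact_mod_cast (S.mul_div hy).symm
  rw [h1, Nat.cast_mul, Nat.cast_mul, h2, Int.cast_sub, Int.cast_mul, Int.cast_natCast]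
  ring

end StarSystem

end StarRefine

section Refinement

variable {M : Type*} [AddCommGroup M] [Module ℝ M] [LinearOrder M] [IsOrderedAddMonoid M]

theorem EdgewiseFace.mem_closure {c : ℕ} {t A : Finset M} (hA : EdgewiseFace c t A) :
    AddSubgroup.closure (A : Set M) ≤ AddSubgroup.closure (t : Set M) := by
  refine (AddSubgroup.closure_le _).2 fun p hp => ?_
  obtain ⟨V, h1, h2, -⟩ := hA
  rw [← h1 p hp]
  exact sum_mem fun l hl => AddSubgroup.subset_closure (h2 p hp l (mem_range.1 hl))

theorem IsFan.edgewiseFace_filter {T : Set (Finset M)} (hT : IsFan T) {O : Set M}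
    [DecidablePred (· ∈ O)] {c : ℕ} {t A : Finset M} (ht : t ∈ T) (hA : EdgewiseFace c t A)
    (h : ∀ p ∈ A, ∃ g ∈ T, (∀ v ∈ g, v ∈ O) ∧ p ∈ coneOf g) :
    EdgewiseFace c (t.filter (· ∈ O)) A := by
  obtain ⟨V, h1, h2, h3, h4⟩ := hA
  refine ⟨V, h1, fun p hp l hl => mem_filter.2 ⟨h2 p hp l hl, ?_⟩, h3, h4⟩
  obtain ⟨g, hg, hgO, hpg⟩ := h p hp
  refine hgO _ (hT.mem_of_mem_coneOf hg ht (h2 p hp l hl) ?_)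
  refine hT.mem_coneOf_of_sum ht hg (s := range c) (f := V p)
    (fun l hl => mem_coneOf_of_mem (h2 p hp l (mem_range.1 hl))) ?_ l (mem_range.2 hl)
  rwa [h1 p hp]

theorem IsFan.sub_mem_closure {K : Set (Finset M)} (hK : IsFan K) {σ τ : Finset M} (hσ : σ ∈ K)
    (hτ : τ ∈ K) {μ : M →₀ ℝ} (hμσ : μ.support ⊆ σ) (h0 : 0 ≤ μ) (h1 : ∀ v, μ v < 1) {b : M}
    (hbσ : b ∈ coneOf σ) (hbτ : b ∈ coneOf τ) (hb : b - bary μ ∈ AddSubgroup.closure (σ : Set M)) :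
    b - bary μ ∈ AddSubgroup.closure (τ : Set M) := by
  obtain ⟨x, hx0, hxσ, rfl⟩ := hbσ
  have hxτ := hK.support_subset_of_mem_coneOf hτ ⟨hx0, hK.down σ hσ _ hxσ⟩ hbτ
  obtain ⟨n, hn, hnint, hnb⟩ := mem_closure_iff.1 hb
  have hnx : n = x - μ := hK.ext_of_subset hσ hn
    (Finsupp.support_sub.trans (union_subset hxσ hμσ)) (by rw [hnb, map_sub])
  have hμτ : μ.support ⊆ τ := fun v hv => by
    refine hxτ (Finsupp.mem_support_iff.2 fun hxv => ?_)
    obtain ⟨k, hk⟩ := hnint v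
    rw [hnx, Finsupp.sub_apply, hxv, zero_sub] at hk
    have h2 := pos_of_mem_support h0 hv
    have h3 := h1 v
    have h4 : (-1 : ℝ) < k := by linarith
    have h5 : (k : ℝ) < 0 := by linarith
    have h6 : (-1 : ℤ) < k := by exact_mod_cast h4
    have h7 : k < 0 := by exact_mod_cast h5
    omega
  refine mem_closure_iff.2 ⟨n, ?_, hnint, hnb⟩
  rw [hnx]
  exact Finsupp.support_sub.trans (union_subset hxτ hμτ)

theorem exists_fract_of_ind_ne_one {Λ : AddSubgroup M} {σ : Finset M} (hσ : ∀ v ∈ σ, v ∈ Λ)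
    (hind : ind Λ σ ≠ 1) : ∃ μ : M →₀ ℝ, μ.support ⊆ σ ∧ 0 ≤ μ ∧ (∀ v, μ v < 1) ∧
      μ.support.Nonempty ∧ bary μ ∈ Λ := by
  rw [ind, ne_eq, AddSubgroup.relIndex_eq_one, SetLike.not_le_iff_exists] at hind
  obtain ⟨x, ⟨hxΛ, hx⟩, hxσ⟩ := hind
  obtain ⟨y, hy, rfl⟩ := mem_span_iff.1 hx
  obtain ⟨w, hw, hw1, hyw⟩ := exists_fract hy
  refine ⟨w, hw, fun v => (hw1 v).1, fun v => (hw1 v).2, ?_, ?_⟩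
  · rw [Finsupp.support_nonempty_iff]
    rintro rfl
    exact hxσ (by simpa using hyw)
  · rw [← sub_sub_cancel (bary y) (bary w)]
    exact sub_mem hxΛ (closure_le_inf hσ hyw).1

/-- A partial refinement `T` of a fan `K` in which the simplices of index at least `I` are
edgewise simplices of members of `Bad`. -/
structure Progress (K : Set (Finset M)) (Λ : AddSubgroup M) (ht : M →ₗ[ℝ] ℝ) (H I : ℕ)
    (T : Set (Finset M)) (c : ℕ) (Old : Set M) (Bad : Finset (Finset M)) : Prop where
  fan : IsFan T
  fin : T.Finite
  carrier_eq : carrier T = carrier K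
  cpos : 0 < c
  level : ∀ s ∈ T, AtLevel Λ ht (c * H) s
  old : ∀ s ∈ T, ∀ g ⊆ s, (∀ v ∈ g, v ∈ Old) → g ∈ edgewise c K
  large : ∀ s ∈ T, I ≤ ind (EdgewiseFan.level Λ ht (c * H)) s →
    (∀ v ∈ s, v ∈ Old) ∧ ∃ σ ∈ Bad, EdgewiseFace c σ s
  le : ∀ s ∈ T, ind (EdgewiseFan.level Λ ht (c * H)) s ≤ I
  bad : ∀ σ ∈ Bad, σ ∈ K ∧ ind (EdgewiseFan.level Λ ht H) σ ≠ 1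

/-- The points at which `T` is starred to remove the class of `bary μ`. -/
def starPoints (T : Set (Finset M)) (Λ : AddSubgroup M) (ht : M →ₗ[ℝ] ℝ) (H c : ℕ) (Old : Set M)
    (Bad : Finset (Finset M)) (μ : M →₀ ℝ) : Set (M →₀ ℝ) :=
  {y | y.support ∈ T ∧ (∀ v ∈ y.support, v ∈ Old) ∧ y.support.Nonempty ∧
    bary y ∈ level Λ ht (c * H) ∧ 0 ≤ y ∧ (∀ v, y v < 1) ∧
    ∃ σ ∈ Bad, μ.support ⊆ σ ∧ EdgewiseFace c σ y.support ∧
      bary y - bary μ ∈ AddSubgroup.closure (σ : Set M)}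

namespace Progress

variable {K : Set (Finset M)} {Λ : AddSubgroup M} {ht : M →ₗ[ℝ] ℝ} {H I : ℕ}
  {T : Set (Finset M)} {c : ℕ} {Old : Set M} {Bad : Finset (Finset M)}

theorem finite_starPoints (R : Progress K Λ ht H I T c Old Bad) (hΛ : BoxFinite Λ) (μ : M →₀ ℝ) :
    (starPoints T Λ ht H c Old Bad μ).Finite := by
  refine Set.Finite.of_finite_image (f := bary) ?_ (R.fan.inj.mono fun y hy => ?_)
  · refine (R.fin.biUnion fun s _ => hΛ s).subset ?_
    rintro _ ⟨y, ⟨h1, -, -, h2, h3, h4, -⟩, rfl⟩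
    exact Set.mem_biUnion h1 ⟨h2.1, y, subset_rfl, fun v => ⟨h3 v, (h4 v).le⟩, rfl⟩
  · exact ⟨hy.2.2.2.2.1, hy.1⟩

theorem starPoints_disj (R : Progress K Λ ht H I T c Old Bad) (hK : IsFan K) (hH : 0 < H)
    (hlev : ∀ s ∈ K, AtLevel Λ ht H s) {μ : M →₀ ℝ} (h0 : 0 ≤ μ) (h1 : ∀ v, μ v < 1) :
    ∀ y ∈ starPoints T Λ ht H c Old Bad μ, ∀ y' ∈ starPoints T Λ ht H c Old Bad μ, ∀ s ∈ T,
      y.support ⊆ s → y'.support ⊆ s → y = y' := by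
  intro y hy y' hy' s hs hys hys'
  obtain ⟨τ, hτ, hE⟩ := R.old s hs (y.support ∪ y'.support) (union_subset hys hys') fun v hv =>
    (mem_union.1 hv).elim (hy.2.1 v) (hy'.2.1 v)
  have key : ∀ u ∈ starPoints T Λ ht H c Old Bad μ, u.support ⊆ y.support ∪ y'.support →
      bary u - bary μ ∈ AddSubgroup.closure (τ : Set M) := by
    rintro u ⟨-, -, -, -, hu, -, σ, hσ, hF, hσu, hcl⟩ hsub
    refine hK.sub_mem_closure (R.bad σ hσ).1 hτ hF h0 h1 ?_ ?_ hcl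
    · exact coneOf_trans (fun p hp => hσu.mem_coneOf hp) ⟨u, hu, subset_rfl, rfl⟩
    · exact coneOf_trans (fun p hp => hE.mem_coneOf hp) ⟨u, hu, hsub, rfl⟩
  have hsupp : (y - y').support ⊆ y.support ∪ y'.support := Finsupp.support_sub
  have hcl : bary (y - y') ∈ AddSubgroup.closure (τ : Set M) := by
    have := sub_mem (key y hy subset_union_left) (key y' hy' subset_union_right)
    rwa [sub_sub_sub_cancel_right, ← map_sub] at this
  have hcl' := hK.mem_closure_of_ht R.cpos hτ hE hH (fun v hv => (hlev τ hτ v hv).2) hcl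
    (mem_span_iff.2 ⟨_, hsupp, rfl⟩) (by
      rw [map_sub]
      exact (mem_level.1 (sub_mem hy.2.2.2.1 hy'.2.2.2.1)).2)
  obtain ⟨n, hn, hnint, hne⟩ := mem_closure_iff.1 hcl'
  have heq := R.fan.ext_of_subset hs (hn.trans (union_subset hys hys'))
    (hsupp.trans (union_subset hys hys')) hne
  refine sub_eq_zero.1 (Finsupp.ext fun v => ?_)
  obtain ⟨k, hk⟩ := hnint v
  rw [heq] at hk
  have e1 : (y - y') v = y v - y' v := rfl
  have a1 : 0 ≤ y v := hy.2.2.2.2.1 v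
  have a2 := hy.2.2.2.2.2.1 v
  have a3 : 0 ≤ y' v := hy'.2.2.2.2.1 v
  have a4 := hy'.2.2.2.2.2.1 v
  have h4 : (-1 : ℝ) < k := by linarith
  have h5 : (k : ℝ) < 1 := by linarith
  have h6 : (-1 : ℤ) < k := by exact_mod_cast h4
  have h7 : k < 1 := by exact_mod_cast h5
  have h8 : k = 0 := by omega
  simpa [h8] using hk

theorem exists_starPoint (R : Progress K Λ ht H I T c Old Bad) (hΛ : BoxFinite Λ) (hK : IsFan K)
    (hH : 0 < H) (hlev : ∀ s ∈ K, AtLevel Λ ht H s)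
    (hle : ∀ s ∈ K, ind (EdgewiseFan.level Λ ht H) s ≤ I)
    {μ : M →₀ ℝ} (h0 : 0 ≤ μ) (h1 : ∀ v, μ v < 1) (hne : μ.support.Nonempty)
    (hμ : bary μ ∈ EdgewiseFan.level Λ ht H) {s : Finset M} (hs : s ∈ T)
    (hsI : I ≤ ind (EdgewiseFan.level Λ ht (c * H)) s) {σ : Finset M} (hσ : σ ∈ Bad)
    (hσs : EdgewiseFace c σ s) (hF : μ.support ⊆ σ) :
    ∃ y ∈ starPoints T Λ ht H c Old Bad μ, y.support ⊆ s := by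
  have hσK := (R.bad σ hσ).1
  set A₁ := EdgewiseFan.level Λ ht (c * H) ⊓ (Submodule.span ℝ (s : Set M)).toAddSubgroup with hA₁
  set A₂ := EdgewiseFan.level Λ ht H ⊓ (Submodule.span ℝ (σ : Set M)).toAddSubgroup with hA₂
  have hA : A₁ ≤ A₂ := inf_le_inf (level_mul_le _ _ _ _) fun x hx => hσs.span_le hx
  have hσΛ := (hlev σ hσK).mem_level
  have hsΛ := (R.level s hs).mem_level
  have hi0 := ind_ne_zero (hΛ.mono (level_le _ ht H)) hσΛ
  have hi1 : (AddSubgroup.closure (σ : Set M)).relIndex A₁ ≠ 0 := fun h =>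
    hi0 (AddSubgroup.relIndex_eq_zero_of_le_right hA h)
  have hcount : ind (EdgewiseFan.level Λ ht (c * H)) s ≤
      (AddSubgroup.closure (σ : Set M)).relIndex A₁ := by
    refine relIndex_le_relIndex le_rfl ?_ hi1
    rintro x ⟨hx, ⟨-, hx'⟩, hxA⟩
    exact hK.mem_closure_of_ht R.cpos hσK hσs hH (fun v hv => (hlev σ hσK v hv).2) hx hxA hx'
  have hsup := le_sup_of_relIndex_le hA (closure_le_inf hσΛ) hi0
    ((hle σ hσK).trans (hsI.trans hcount))
  obtain ⟨b, hb, n, hn, hbn⟩ := AddSubgroup.mem_sup.1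
    (hsup (show bary μ ∈ A₂ from ⟨hμ, mem_span_iff.2 ⟨μ, hF, rfl⟩⟩))
  obtain ⟨y, hy, rfl⟩ := mem_span_iff.1 hb.2
  obtain ⟨w, hw, hw1, hyw⟩ := exists_fract hy
  have hwμ : bary w - bary μ ∈ AddSubgroup.closure (σ : Set M) := by
    have := add_mem (hσs.mem_closure hyw) hn
    rw [← neg_mem_iff] at this
    convert this using 1
    rw [← hbn]; abel
  refine ⟨w, ⟨R.fan.down s hs _ hw, fun v hv => (R.large s hs hsI).1 v (hw hv), ?_, ?_,
    fun v => (hw1 v).1, fun v => (hw1 v).2, σ, hσ, hF, hσs.subset hw, hwμ⟩, hw⟩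
  · rw [Finsupp.support_nonempty_iff]
    rintro rfl
    rw [map_zero, zero_sub, neg_mem_iff] at hwμ
    obtain ⟨n, hn, hnint, hnμ⟩ := mem_closure_iff.1 hwμ
    have := hK.ext_of_subset hσK hn hF hnμ
    subst this
    obtain ⟨v, hv⟩ := hne
    obtain ⟨k, hk⟩ := hnint v
    have h2 := pos_of_mem_support h0 hv
    have h3 := h1 v
    rw [hk] at h2 h3
    have h6 : (0 : ℤ) < k := by exact_mod_cast h2
    have h7 : k < 1 := by exact_mod_cast h3
    omega
  · rw [← sub_sub_cancel (bary y) (bary w)]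
    exact sub_mem hb.1 (closure_le_inf hsΛ hyw).1

theorem starSystem (R : Progress K Λ ht H I T c Old Bad) (hΛ : BoxFinite Λ) (hK : IsFan K)
    (hH : 0 < H) (hlev : ∀ s ∈ K, AtLevel Λ ht H s) {μ : M →₀ ℝ} (h0 : 0 ≤ μ)
    (h1 : ∀ v, μ v < 1) :
    ∃ h a, StarSystem T Λ ht (c * H) (starPoints T Λ ht H c Old Bad μ) h a := by
  have hcH : 0 < c * H := Nat.mul_pos R.cpos hH
  have key : ∀ y ∈ starPoints T Λ ht H c Old Bad μ, ∃ k : ℕ, 0 < k ∧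
      ht (bary y) = k * (c * H : ℕ) := by
    rintro y ⟨hyT, -, hne, ⟨-, k, hk⟩, hy0, -⟩
    have htot := map_bary_of_const ht (fun v hv => (R.level _ hyT v hv).2) subset_rfl (y := y)
    have hcH' : (0 : ℝ) < (c * H : ℕ) := by exact_mod_cast hcH
    have : (0 : ℝ) < total y := by
      rw [linearCombination_eq_sum _ subset_rfl]
      exact sum_pos (fun v hv => by simpa using pos_of_mem_support hy0 hv) hne
    have hkpos : (0 : ℝ) < k := by
      rw [hk] at htot
      rw [mul_right_cancel₀ hcH'.ne' htot]
      exact this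
    have hk0 : 0 < k := by exact_mod_cast hkpos
    refine ⟨k.toNat, by omega, ?_⟩
    rw [hk]
    congr 1
    exact_mod_cast (Int.toNat_of_nonneg hk0.le).symm
  choose! h hpos hht using key
  have hfin := R.finite_starPoints hΛ μ
  refine ⟨h, ∏ y ∈ hfin.toFinset, h y, ?_⟩
  exact {
    fan := R.fan
    fin := R.fin
    level := R.level
    hpos := hcH
    cpos := prod_pos fun y hy => hpos y (hfin.mem_toFinset.1 hy)
    finite := hfin
    mem := fun y hy => hy.1
    nonneg := fun y hy => hy.2.2.2.2.1
    lt_one := fun y hy => hy.2.2.2.2.2.1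
    nonempty := fun y hy => hy.2.2.1
    lat := fun y hy => hy.2.2.2.1.1
    height := hht
    pos := hpos
    dvd := fun y hy => dvd_prod_of_mem _ (hfin.mem_toFinset.2 hy)
    disj := R.starPoints_disj hK hH hlev h0 h1 }

variable [TopologicalSpace M] [IsTopologicalAddGroup M] [ContinuousSMul ℝ M] [T2Space M]

theorem step (R : Progress K Λ ht H I T c Old Bad) (hΛ : BoxFinite Λ) (hK : IsFan K)
    (hH : 0 < H) (hlev : ∀ s ∈ K, AtLevel Λ ht H s)
    (hle : ∀ s ∈ K, ind (EdgewiseFan.level Λ ht H) s ≤ I) (hBad : Bad.Nonempty) :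
    ∃ T' c' Old' Bad', Bad' ⊂ Bad ∧ Progress K Λ ht H I T' c' Old' Bad' := by
  classical
  obtain ⟨σ₀, hσ₀⟩ := hBad
  obtain ⟨hσ₀K, hind⟩ := R.bad σ₀ hσ₀
  obtain ⟨μ, hμσ, h0, h1, hne, hμ⟩ := exists_fract_of_ind_ne_one (hlev σ₀ hσ₀K).mem_level hind
  obtain ⟨h, a, S⟩ := R.starSystem hΛ hK hH hlev h0 h1
  set Φ := starPoints T Λ ht H c Old Bad μ with hΦ
  have hca : c * a * H = a * (c * H) := by ring
  refine ⟨starRefine T Φ h a, c * a,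
    {p | ∃ g ∈ T, (∀ v ∈ g, v ∈ Old) ∧ (∀ y ∈ Φ, ¬ y.support ⊆ g) ∧ p ∈ coneOf g},
    Bad.filter (¬ μ.support ⊆ ·), filter_ssubset.2 ⟨σ₀, hσ₀, not_not.2 hμσ⟩, ?_⟩
  exact {
    fan := S.starRefine_fan
    fin := S.starRefine_finite
    carrier_eq := S.carrier_starRefine.trans R.carrier_eq
    cpos := Nat.mul_pos R.cpos S.cpos
    level := by
      rw [hca]
      exact S.starRefine_atLevel
    old := by
      intro s hs g hgs hg
      have : ∃ t ∈ T, EdgewiseFace a t g := by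
        rcases hs with ⟨t, hts, hs⟩ | ⟨y, hy, B, ⟨t, htT, hB⟩, hA⟩
        · exact ⟨t, hts.1, hs.subset hgs⟩
        · refine ⟨t, htT.1, ?_⟩
          rw [← S.mul_div hy]
          refine S.fan.edgewiseFace_of_sum_mem (S.nonneg y hy) (S.mem y hy) htT hB (hA.subset hgs)
            fun p hp => ?_
          obtain ⟨g', hg', -, hyg, hpg⟩ := hg p hp
          exact ⟨g', hg', hyg y hy, hpg⟩
      obtain ⟨t, htT, hgt⟩ := this
      have hgt' := R.fan.edgewiseFace_filter (O := Old) htT hgt fun p hp => by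
        obtain ⟨g', hg', hO, -, hpg⟩ := hg p hp
        exact ⟨g', hg', hO, hpg⟩
      obtain ⟨τ, hτ, hE⟩ := R.old t htT (t.filter (· ∈ Old)) (filter_subset _ _)
        fun v hv => (mem_filter.1 hv).2
      exact ⟨τ, hτ, hgt'.trans hE⟩
    large := by
      rw [hca]
      rintro s (⟨t, hts, hs⟩ | ⟨y, hy, B, ⟨t, htT, hB⟩, hA⟩) hI
      · have htI := hI.trans (S.ind_outside_le hΛ hts.1 hs)
        obtain ⟨hO, σ, hσ, hσt⟩ := R.large t hts.1 htI
        refine ⟨fun p hp => ⟨t, hts.1, hO, hts.2, hs.mem_coneOf hp⟩, σ,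
          mem_filter.2 ⟨hσ, fun hF => ?_⟩,
          hs.trans hσt⟩
        obtain ⟨y, hy, hyt⟩ := R.exists_starPoint hΛ hK hH hlev hle h0 h1 hne hμ hts.1 htI hσ hσt hF
        exact hts.2 y hy hyt
      · exact absurd (S.ind_starPiece_lt hΛ hy htT hB hA)
          (not_lt.2 ((R.le _ htT.2.2).trans hI))
    le := by
      rw [hca]
      rintro s (⟨t, hts, hs⟩ | ⟨y, hy, B, ⟨t, htT, hB⟩, hA⟩)
      · exact (S.ind_outside_le hΛ hts.1 hs).trans (R.le t hts.1)
      · exact (S.ind_starPiece_lt hΛ hy htT hB hA).le.trans (R.le _ htT.2.2)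
    bad := fun σ hσ => R.bad σ (mem_filter.1 hσ).1 }

theorem exists_ind_lt (hΛ : BoxFinite Λ) (hK : IsFan K) (hH : 0 < H)
    (hlev : ∀ s ∈ K, AtLevel Λ ht H s) (hle : ∀ s ∈ K, ind (EdgewiseFan.level Λ ht H) s ≤ I)
    (R : Progress K Λ ht H I T c Old Bad) :
    ∃ T' c', IsFan T' ∧ T'.Finite ∧ carrier T' = carrier K ∧ 0 < c' ∧
      (∀ s ∈ T', AtLevel Λ ht (c' * H) s) ∧
      ∀ s ∈ T', ind (EdgewiseFan.level Λ ht (c' * H)) s < I := by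
  induction Bad using Finset.strongInduction generalizing T c Old with
  | H Bad ih =>
    rcases Bad.eq_empty_or_nonempty with rfl | hne
    · refine ⟨T, c, R.fan, R.fin, R.carrier_eq, R.cpos, R.level, fun s hs => ?_⟩
      by_contra! hI
      obtain ⟨-, σ, hσ, -⟩ := R.large s hs hI
      simp at hσ
    · obtain ⟨T', c', Old', Bad', hB, R'⟩ := R.step hΛ hK hH hlev hle hne
      exact ih Bad' hB R'

end Progress

variable [TopologicalSpace M] [IsTopologicalAddGroup M] [ContinuousSMul ℝ M] [T2Space M]

theorem exists_refinement_ind_lt {K : Set (Finset M)} {Λ : AddSubgroup M} {ht : M →ₗ[ℝ] ℝ}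
    {H I : ℕ} (hΛ : BoxFinite Λ) (hK : IsFan K) (hfin : K.Finite) (hH : 0 < H)
    (hlev : ∀ s ∈ K, AtLevel Λ ht H s) (hle : ∀ s ∈ K, ind (level Λ ht H) s ≤ I) (hI : 1 < I) :
    ∃ T' c', IsFan T' ∧ T'.Finite ∧ carrier T' = carrier K ∧ 0 < c' ∧
      (∀ s ∈ T', AtLevel Λ ht (c' * H) s) ∧
      ∀ s ∈ T', ind (level Λ ht (c' * H)) s < I := by
  classical
  refine Progress.exists_ind_lt (T := K) (c := 1) (Old := Set.univ)
    (Bad := hfin.toFinset.filter fun σ => I ≤ ind (level Λ ht H) σ) hΛ hK hH hlev hle ?_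
  exact {
    fan := hK
    fin := hfin
    carrier_eq := rfl
    cpos := one_pos
    level := by simpa using hlev
    old := fun s hs g hg _ => ⟨g, hK.down s hs g hg, edgewiseFace_one g⟩
    large := by
      rw [one_mul]
      exact fun s hs hI => ⟨fun _ _ => trivial, s, by simp [hs, hI], edgewiseFace_one s⟩
    le := by simpa using hle
    bad := by
      intro σ hσ
      rw [mem_filter, hfin.mem_toFinset] at hσ
      exact ⟨hσ.1, by omega⟩ }

theorem exists_refinement_ind_eq_one {Λ : AddSubgroup M} (hΛ : BoxFinite Λ) {ht : M →ₗ[ℝ] ℝ}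
    {K : Set (Finset M)} {H I : ℕ} (hK : IsFan K) (hfin : K.Finite) (hH : 0 < H)
    (hlev : ∀ s ∈ K, AtLevel Λ ht H s) (hle : ∀ s ∈ K, ind (level Λ ht H) s ≤ I) :
    ∃ T c, IsFan T ∧ T.Finite ∧ carrier T = carrier K ∧ 0 < c ∧
      (∀ s ∈ T, AtLevel Λ ht c s) ∧ ∀ s ∈ T, ind (level Λ ht c) s = 1 := by
  induction I using Nat.strong_induction_on generalizing K H with
  | h I ih =>
    by_cases hI : 1 < I
    · obtain ⟨T, c, h1, h2, h3, h4, h5, h6⟩ :=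
        exists_refinement_ind_lt hΛ hK hfin hH hlev hle hI
      rw [← h3]
      exact ih (I - 1) (by omega) h1 h2 (Nat.mul_pos h4 hH) h5
        fun s hs => Nat.le_sub_one_of_lt (h6 s hs)
    · refine ⟨K, H, hK, hfin, rfl, hH, hlev, fun s hs => ?_⟩
      have h1 := hle s hs
      have h2 := ind_ne_zero (hΛ.mono (level_le _ _ _)) (hlev s hs).mem_level
      omega

/-- The cone over finitely many lattice points of height one is the union of a fan of unimodular
simplices of some height. -/
theorem exists_unimodular_fan {Λ : AddSubgroup M} (hΛ : BoxFinite Λ) {ht : M →ₗ[ℝ] ℝ}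
    {V : Finset M} (hV : AtLevel Λ ht 1 V) :
    ∃ T c, IsFan T ∧ T.Finite ∧ carrier T = coneOf V ∧ 0 < c ∧
      (∀ s ∈ T, AtLevel Λ ht c s) ∧ ∀ s ∈ T, ind (level Λ ht c) s = 1 := by
  obtain ⟨K, hK, hfin, hKV, hcar⟩ := exists_isFan V
  rw [← hcar]
  refine exists_refinement_ind_eq_one (I := ∑ s ∈ hfin.toFinset, ind (level Λ ht 1) s) hΛ hK hfin
    one_pos (fun s hs v hv => hV v (hKV s hs hv)) fun s hs => ?_
  exact single_le_sum (f := fun s => ind (level Λ ht 1) s) (fun _ _ => Nat.zero_le _)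
    (hfin.mem_toFinset.2 hs)

end Refinement

section Order

theorem exists_linearOrder_isOrderedAddMonoid (M : Type*) [AddCommGroup M] [Module ℝ M] :
    ∃ _ : LinearOrder M, IsOrderedAddMonoid M := by
  classical
  let b := Module.Basis.ofVectorSpace ℝ M
  let _ : LinearOrder (Module.Basis.ofVectorSpaceIndex ℝ M) := linearOrderOfSTO WellOrderingRel
  let f : M → Lex (Module.Basis.ofVectorSpaceIndex ℝ M →₀ ℝ) := fun x => toLex (b.repr x)
  have hf : Function.Injective f := fun x y h => b.repr.injective (toLex.injective h)
  let _ : LinearOrder M := LinearOrder.lift' f hf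
  exact ⟨inferInstance, ⟨fun x y h z => by
    change f (x + z) ≤ f (y + z)
    have h : f x ≤ f y := h
    simp only [f, map_add, toLex_add]
    exact add_le_add_left h _, fun x y h z => by
    change f (z + x) ≤ f (z + y)
    have h : f x ≤ f y := h
    simp only [f, map_add, toLex_add]
    exact add_le_add_right h _⟩⟩

end Order

section Slice

variable {E : Type*} [AddCommGroup E] [Module ℝ E]

/-- The simplex at height `c` of a cone whose generators have height `c`. -/
def slice (s : Finset (E × ℝ)) : Set E := convexHull ℝ (Prod.fst '' (s : Set (E × ℝ)))

theorem fst_mem_slice {s : Finset (E × ℝ)} {v : E × ℝ} (hv : v ∈ s) : v.1 ∈ slice s :=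
  subset_convexHull ℝ _ ⟨v, hv, rfl⟩

theorem slice_mono {s t : Finset (E × ℝ)} (h : s ⊆ t) : slice s ⊆ slice t :=
  convexHull_mono (Set.image_mono h)

theorem map_bary {N : Type*} [AddCommGroup N] [Module ℝ N] (f : E →ₗ[ℝ] N) {s : Finset E}
    {y : E →₀ ℝ} (hy : y.support ⊆ s) : f (bary y) = ∑ v ∈ s, y v • f v := by
  simp [bary_eq_sum hy]

theorem sum_coeff_mul {s : Finset (E × ℝ)} {c : ℝ} (hs : ∀ v ∈ s, v.2 = c) {y : E × ℝ →₀ ℝ}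
    (hy : y.support ⊆ s) : (bary y).2 = (∑ v ∈ s, y v) * c := by
  have h := map_bary (LinearMap.snd ℝ E ℝ) hy
  rw [LinearMap.snd_apply] at h
  rw [h, sum_mul]
  exact sum_congr rfl fun v hv => by simp [hs v hv]

theorem mem_slice {s : Finset (E × ℝ)} {c : ℝ} (hc : 0 < c) (hs : ∀ v ∈ s, v.2 = c) {x : E} :
    x ∈ slice s ↔ (x, c) ∈ coneOf s := by
  constructor
  · intro hx
    refine convexHull_min (t := {x | (x, c) ∈ coneOf s}) ?_ ?_ hx
    · rintro _ ⟨v, hv, rfl⟩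
      have : (v.1, c) = v := by rw [← hs v hv]
      simpa [this] using mem_coneOf_of_mem hv
    · intro a ha b hb p q hp hq hpq
      have h := add_mem_coneOf (smul_mem_coneOf hp ha) (smul_mem_coneOf hq hb)
      have e : p • (a, c) + q • (b, c) = (p • a + q • b, c) := by
        ext
        · simp
        · simp [← add_mul, hpq]
      change _ ∈ coneOf s
      rwa [← e]
  · rintro ⟨y, h0, hy, hx⟩
    have h1 := sum_coeff_mul hs hy
    rw [hx] at h1
    have h2 : ∑ v ∈ s, y v = 1 := by
      have : (1 - ∑ v ∈ s, y v) * c = 0 := by linarith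
      rcases mul_eq_zero.1 this with h | h <;> linarith
    have h3 := map_bary (LinearMap.fst ℝ E ℝ) hy
    rw [hx, LinearMap.fst_apply] at h3
    change x = _ at h3
    rw [h3]
    exact (convex_convexHull ℝ _).sum_mem (fun v _ => h0 v) h2 fun v hv => fst_mem_slice hv

theorem setOf_isMaxOn_slice {s s' : Finset (E × ℝ)} {c : ℝ} (hc : 0 < c) (hs : ∀ v ∈ s, v.2 = c)
    (hs' : s' ⊆ s) (hne : s'.Nonempty) {φ : E →ₗ[ℝ] ℝ} {m : ℝ} (hle : ∀ v ∈ s, φ v.1 ≤ m)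
    (hm : ∀ v ∈ s, v ∈ s' ↔ φ v.1 = m) :
    {x ∈ slice s | ∀ y ∈ slice s, φ y ≤ φ x} = slice s' := by
  have hle' : ∀ x ∈ slice s, φ x ≤ m := fun x hx => by
    refine convexHull_min (t := {x | φ x ≤ m}) ?_ (convex_halfSpace_le φ.isLinear m) hx
    rintro _ ⟨v, hv, rfl⟩
    exact hle v hv
  have heq : ∀ x ∈ slice s', φ x = m := fun x hx => by
    refine convexHull_min (t := {x | φ x = m}) ?_ (convex_hyperplane φ.isLinear m) hx
    rintro _ ⟨v, hv, rfl⟩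
    exact (hm v (hs' hv)).1 hv
  ext x
  constructor
  · rintro ⟨hx, hmax⟩
    obtain ⟨v₀, hv₀⟩ := hne
    have hxm : m ≤ φ x := heq _ (fst_mem_slice hv₀) ▸ hmax _ (fst_mem_slice (hs' hv₀))
    obtain ⟨y, h0, hy, hyx⟩ := (mem_slice hc hs).1 hx
    refine (mem_slice hc fun v hv => hs v (hs' hv)).2 ⟨y, h0, fun v hv => ?_, hyx⟩
    have h1 := map_bary ((m / c) • LinearMap.snd ℝ E ℝ - φ ∘ₗ LinearMap.fst ℝ E ℝ) hy
    rw [hyx] at h1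
    have hval : ∀ v ∈ s, ((m / c) • LinearMap.snd ℝ E ℝ - φ ∘ₗ LinearMap.fst ℝ E ℝ) v
        = m - φ v.1 := fun v hv => by
      simp [hs v hv, hc.ne']
    have h2 : ∑ v ∈ s, y v * (m - φ v.1) = m - φ x := by
      rw [← sum_congr rfl fun v hv => by rw [← hval v hv, ← smul_eq_mul], ← h1]
      simp [hc.ne']
    have h3 : ∀ v ∈ s, 0 ≤ y v * (m - φ v.1) := fun v hv =>
      mul_nonneg (h0 v) (by linarith [hle v hv])
    have h4 := (sum_eq_zero_iff_of_nonneg h3).1 (le_antisymm (by linarith) (sum_nonneg h3))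
    refine (hm v (hy hv)).2 ?_
    rcases mul_eq_zero.1 (h4 v (hy hv)) with h | h
    · exact absurd h (Finsupp.mem_support_iff.1 hv)
    · linarith
  · exact fun hx => ⟨slice_mono hs' hx, fun y hy => (hle' y hy).trans (heq x hx).ge⟩

theorem IsFan.linearIndepOn {K : Set (Finset E)} (hK : IsFan K) {s : Finset E} (hs : s ∈ K) :
    LinearIndepOn ℝ id (s : Set E) := by
  refine linearIndepOn_iff.2 fun l hl h => hK.ext_of_subset hs ?_ (by simp)
    (h.trans (map_zero _).symm)
  exact_mod_cast (Finsupp.mem_supported ℝ l).1 hl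

theorem IsFan.exists_dual {K : Set (Finset E)} (hK : IsFan K) {s : Finset E} (hs : s ∈ K)
    (f : E → ℝ) : ∃ g : E →ₗ[ℝ] ℝ, ∀ v ∈ s, g v = f v := by
  have h := hK.linearIndepOn hs
  let b := Module.Basis.extend h
  refine ⟨b.constr ℝ fun i => f i, fun v hv => ?_⟩
  have h1 := b.constr_basis ℝ (fun i => f i) ⟨v, h.subset_extend (Set.subset_univ _) hv⟩
  rwa [Module.Basis.extend_apply_self] at h1

/-- Every nonempty subset of the generators of a member of a fan spans a face. -/
theorem IsFan.exists_face {K : Set (Finset (E × ℝ))} (hK : IsFan K) {s s' : Finset (E × ℝ)}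
    (hsK : s ∈ K) {c : ℝ} (hc : 0 < c) (hs : ∀ v ∈ s, v.2 = c) (hs' : s' ⊆ s)
    (hne : s'.Nonempty) :
    ∃ φ : E →ₗ[ℝ] ℝ, {x ∈ slice s | ∀ y ∈ slice s, φ y ≤ φ x} = slice s' := by
  classical
  obtain ⟨g, hg⟩ := hK.exists_dual hsK fun v => if v ∈ s' then 1 else 0
  refine ⟨g ∘ₗ LinearMap.inl ℝ E ℝ, setOf_isMaxOn_slice hc hs hs' hne
    (m := 1 - g (0, c)) (fun v hv => ?_) fun v hv => ?_⟩
  all_goals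
    have h1 : g (v.1, 0) = g v - g (0, c) := by
      rw [← map_sub, ← hs v hv]
      congr 1
      ext <;> simp
    simp only [LinearMap.comp_apply, LinearMap.inl_apply, h1, hg v hv]
    split_ifs with h <;> simp [h, -zero_sub]

theorem IsFan.affineIndependent {K : Set (Finset (E × ℝ))} (hK : IsFan K) [DecidableEq E]
    {s : Finset (E × ℝ)} (hsK : s ∈ K) {c : ℝ} (hs : ∀ v ∈ s, v.2 = c) :
    AffineIndependent ℝ (Subtype.val : ↥((s.image Prod.fst : Finset E) : Set E) → E) := by
  have h : AffineIndependent ℝ (fun v : s => v.1.1) := by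
    refine affineIndependent_iff.2 fun t w h0 h1 => ?_
    have hli : LinearIndependent ℝ (fun v : s => v.1) := hK.linearIndepOn hsK
    refine linearIndependent_iff'.1 hli t w ?_
    ext
    · simpa [Prod.fst_sum] using h1
    · rw [Prod.snd_sum, Prod.snd_zero, ← zero_mul c, ← h0, sum_mul]
      exact sum_congr rfl fun v _ => by simp [hs v.1 v.2]
  have h2 := h.range
  have e : Set.range (fun v : s => v.1.1) = ((s.image Prod.fst : Finset E) : Set E) := by
    ext x
    simp
  rwa [e] at h2

theorem IsFan.extremePoints_slice {K : Set (Finset (E × ℝ))} (hK : IsFan K)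
    {s : Finset (E × ℝ)} (hsK : s ∈ K) {c : ℝ} (hc : 0 < c) (hs : ∀ v ∈ s, v.2 = c) :
    (slice s).extremePoints ℝ = Prod.fst '' (s : Set (E × ℝ)) := by
  refine subset_antisymm extremePoints_convexHull_subset ?_
  rintro _ ⟨v, hv, rfl⟩
  obtain ⟨φ, hφ⟩ := hK.exists_face hsK hc hs (singleton_subset_iff.2 hv) (singleton_nonempty v)
  have hsing : slice {v} = {v.1} := by simp [slice]
  rw [hsing] at hφ
  have hmem : v.1 ∈ {x ∈ slice s | ∀ y ∈ slice s, φ y ≤ φ x} := hφ ▸ rfl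
  refine mem_extremePoints_iff_left.2 ⟨hmem.1, fun a ha b hb hab => ?_⟩
  have h1 := hmem.2 a ha
  have h2 := hmem.2 b hb
  obtain ⟨p, q, hp, hq, hpq, h⟩ := hab
  have h3 := congrArg φ h
  simp only [map_add, map_smul, smul_eq_mul] at h3
  have h4 : φ a = φ v.1 := by
    refine le_antisymm h1 ?_
    by_contra! hlt
    have h5 : (p + q) * φ v.1 = φ v.1 := by rw [hpq, one_mul]
    linarith [mul_lt_mul_of_pos_left hlt hp, mul_le_mul_of_nonneg_left h2 hq.le]
  have : a ∈ ({v.1} : Set E) := hφ ▸ ⟨ha, fun y hy => h4 ▸ hmem.2 y hy⟩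
  exact this

theorem IsFan.slice_inter [DecidableEq E] {K : Set (Finset (E × ℝ))} (hK : IsFan K) {c : ℝ}
    (hc : 0 < c) {s t : Finset (E × ℝ)} (hsK : s ∈ K) (htK : t ∈ K) (hs : ∀ v ∈ s, v.2 = c)
    (ht : ∀ v ∈ t, v.2 = c) : slice s ∩ slice t = slice (s ∩ t) := by
  refine subset_antisymm ?_ (Set.subset_inter (slice_mono inter_subset_left)
    (slice_mono inter_subset_right))
  rintro x ⟨hx, hx'⟩
  obtain ⟨y, h0, hy, hyx⟩ := (mem_slice hc hs).1 hx
  have h1 := hK.support_subset_of_mem_coneOf htK ⟨h0, hK.down s hsK _ hy⟩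
    (hyx ▸ (mem_slice hc ht).1 hx')
  exact (mem_slice hc fun v hv => hs v (inter_subset_left hv)).2
    ⟨y, h0, subset_inter hy h1, hyx⟩

theorem iUnion_slice {K : Set (Finset (E × ℝ))} (hK : IsFan K) {c : ℝ} (hc : 0 < c)
    (hs : ∀ s ∈ K, ∀ v ∈ s, v.2 = c) :
    ⋃₀ {S | ∃ s ∈ K, s.Nonempty ∧ S = slice s} = {x | (x, c) ∈ carrier K} := by
  rw [carrier_eq_iUnion hK.down]
  ext x
  simp only [Set.mem_sUnion, Set.mem_ofPred_eq, Set.mem_iUnion, exists_prop]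
  constructor
  · rintro ⟨_, ⟨s, hsK, -, rfl⟩, hx⟩
    exact ⟨s, hsK, (mem_slice hc (hs s hsK)).1 hx⟩
  · rintro ⟨s, hsK, hx⟩
    have h := (mem_slice hc (hs s hsK)).2 hx
    refine ⟨_, ⟨s, hsK, ?_, rfl⟩, h⟩
    rw [slice] at h
    simpa using convexHull_nonempty_iff.1 ⟨x, h⟩

theorem mem_coneOf_iff_mem_smul [DecidableEq E] (V : Finset E) {c : ℝ} (hc : 0 < c) {x : E} :
    (x, c) ∈ coneOf (V.image fun v => (v, (1 : ℝ))) ↔ x ∈ c • convexHull ℝ (V : Set E) := by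
  have h : convexHull ℝ (V : Set E) = slice (V.image fun v => (v, (1 : ℝ))) := by
    simp [slice, Set.image_image]
  rw [Set.mem_smul_set_iff_inv_smul_mem₀ hc.ne', h, mem_slice one_pos (by simp)]
  constructor
  · intro h
    simpa [hc.ne'] using smul_mem_coneOf (inv_nonneg.2 hc.le) h
  · intro h
    simpa [hc.ne'] using smul_mem_coneOf hc.le h

end Slice

section Lattice

variable {d : ℕ}

/-- The integral points of `ℝ^d × ℝ`. -/
def heightLattice (d : ℕ) : AddSubgroup ((Fin d → ℝ) × ℝ) :=
  (intLattice d).prod (AddSubgroup.zmultiples 1)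

theorem boxFinite_heightLattice (d : ℕ) : BoxFinite (heightLattice d) := by
  intro s
  obtain ⟨N, hN⟩ := exists_nat_ge (∑ v ∈ s, ‖v‖)
  let f : (Fin d → ℤ) × ℤ → (Fin d → ℝ) × ℝ := fun p => (fun i => (p.1 i : ℝ), (p.2 : ℝ))
  refine (((Set.finite_Icc (fun _ : Fin d => -(N : ℤ)) fun _ => (N : ℤ)).prod
    (Set.finite_Icc (-(N : ℤ)) N)).image f).subset ?_
  rintro x ⟨⟨hx1, hx2⟩, y, hy, hy01, rfl⟩
  have hnorm : ‖bary y‖ ≤ N := by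
    rw [bary_eq_sum hy]
    refine (norm_sum_le _ _).trans ((sum_le_sum fun v _ => ?_).trans hN)
    rw [norm_smul, Real.norm_of_nonneg (hy01 v).1]
    exact mul_le_of_le_one_left (norm_nonneg _) (hy01 v).2
  choose z hz using hx1
  obtain ⟨k, hk⟩ := AddSubgroup.mem_zmultiples_iff.1 hx2
  have hk : (bary y).2 = k := by rw [← hk]; simp
  have bound : ∀ {n : ℤ} {r : ℝ}, r = n → |r| ≤ ‖bary y‖ → -(N : ℤ) ≤ n ∧ n ≤ N := by
    rintro n _ rfl h
    have h := abs_le.1 (h.trans hnorm)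
    exact ⟨by exact_mod_cast h.1, by exact_mod_cast h.2⟩
  have b1 := fun i => bound (hz i) ((norm_le_pi_norm (bary y).1 i).trans (norm_fst_le _))
  have b2 := bound hk (norm_snd_le (bary y))
  exact ⟨(z, k), ⟨⟨fun i => (b1 i).1, fun i => (b1 i).2⟩, b2⟩,
    Prod.ext (funext fun i => (hz i).symm) hk.symm⟩

theorem isIntegralSimplex_slice {K : Set (Finset ((Fin d → ℝ) × ℝ))} (hK : IsFan K) {c : ℕ}
    {s : Finset ((Fin d → ℝ) × ℝ)} (hsK : s ∈ K) (hne : s.Nonempty)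
    (hs : AtLevel (heightLattice d) (LinearMap.snd ℝ _ ℝ) c s) : IsIntegralSimplex (slice s) := by
  classical
  refine ⟨s.image Prod.fst, hne.image _, fun v hv => ?_,
    hK.affineIndependent hsK fun v hv => (hs v hv).2, by simp [slice]⟩
  obtain ⟨w, hw, rfl⟩ := mem_image.1 hv
  exact (hs w hw).1.1

theorem polyIndex_slice {K : Set (Finset ((Fin d → ℝ) × ℝ))} (hK : IsFan K) {c : ℕ} (hc : 0 < c)
    {s : Finset ((Fin d → ℝ) × ℝ)} (hsK : s ∈ K) (hne : s.Nonempty)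
    (hs : AtLevel (heightLattice d) (LinearMap.snd ℝ _ ℝ) c s)
    (hind : ind (level (heightLattice d) (LinearMap.snd ℝ _ ℝ) c) s = 1) :
    polyIndex (slice s) = 1 := by
  have hc' : (0 : ℝ) < c := by exact_mod_cast hc
  have hs2 : ∀ v ∈ s, v.2 = (c : ℝ) := fun v hv => (hs v hv).2
  have hext := hK.extremePoints_slice hsK hc' hs2
  rw [polyIndex]
  change (latL (slice s)).relIndex (latN (slice s)) = 1
  rw [AddSubgroup.relIndex_eq_one]
  rintro x ⟨hx, hxZ⟩
  have hspan : Submodule.span ℝ (vertexDiffs (slice s)) ≤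
      (Submodule.span ℝ (s : Set ((Fin d → ℝ) × ℝ))).comap (LinearMap.inl ℝ _ ℝ) := by
    refine Submodule.span_le.2 ?_
    rintro _ ⟨u, hu, v, hv, rfl⟩
    rw [hext] at hu hv
    obtain ⟨u, hu, rfl⟩ := hu
    obtain ⟨v, hv, rfl⟩ := hv
    have h : LinearMap.inl ℝ (Fin d → ℝ) ℝ (u.1 - v.1) = u - v := by
      ext
      · simp
      · simp [hs2 u hu, hs2 v hv]
    rw [SetLike.mem_coe, Submodule.mem_comap, h]
    exact sub_mem (Submodule.subset_span hu) (Submodule.subset_span hv)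
  rw [ind, AddSubgroup.relIndex_eq_one] at hind
  have hmem : (x, (0 : ℝ)) ∈ AddSubgroup.closure (s : Set ((Fin d → ℝ) × ℝ)) :=
    hind ⟨mem_level.2 ⟨⟨hxZ, zero_mem _⟩, 0, by simp⟩, hspan hx⟩
  obtain ⟨y, hy, hnint, hyx⟩ := mem_closure_iff.1 hmem
  have h0 := sum_coeff_mul hs2 hy
  rw [hyx] at h0
  have h0 : ∑ v ∈ s, y v = 0 := (mul_eq_zero.1 h0.symm).resolve_right hc'.ne'
  have h1 := map_bary (LinearMap.fst ℝ (Fin d → ℝ) ℝ) hy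
  rw [hyx] at h1
  obtain ⟨v₀, hv₀⟩ := hne
  have h2 : x = ∑ v ∈ s, y v • (v.1 - v₀.1) := by
    simp only [smul_sub, sum_sub_distrib, ← sum_smul, h0, zero_smul, sub_zero]
    exact h1
  rw [h2]
  refine sum_mem fun v hv => ?_
  obtain ⟨n, hn⟩ := hnint v
  rw [hn, Int.cast_smul_eq_zsmul]
  have hmem : v.1 - v₀.1 ∈ vertexDiffs (slice s) :=
    ⟨v.1, hext ▸ ⟨v, hv, rfl⟩, v₀.1, hext ▸ ⟨v₀, hv₀, rfl⟩, rfl⟩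
  exact zsmul_mem (AddSubgroup.subset_closure hmem) n

theorem isTriangulation_slices {K : Set (Finset ((Fin d → ℝ) × ℝ))} (hK : IsFan K)
    (hfin : K.Finite) {c : ℕ} (hc : 0 < c)
    (hs : ∀ s ∈ K, AtLevel (heightLattice d) (LinearMap.snd ℝ _ ℝ) c s) :
    IsTriangulation {S | ∃ s ∈ K, s.Nonempty ∧ S = slice s} {x | (x, (c : ℝ)) ∈ carrier K} := by
  classical
  have hc' : (0 : ℝ) < c := by exact_mod_cast hc
  have hs2 : ∀ s ∈ K, ∀ v ∈ s, v.2 = (c : ℝ) := fun s hs' v hv => (hs s hs' v hv).2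
  refine ⟨(hfin.image slice).subset ?_, ?_, iUnion_slice hK hc' hs2, ?_, ?_⟩
  · rintro _ ⟨s, hsK, -, rfl⟩
    exact ⟨s, hsK, rfl⟩
  · rintro _ ⟨s, hsK, hne, rfl⟩
    obtain ⟨V, h1, -, h2⟩ := isIntegralSimplex_slice hK hsK hne (hs s hsK)
    exact ⟨V, h1, h2⟩
  · rintro _ ⟨s, hsK, hne, rfl⟩ F ⟨-, φ, rfl⟩
    obtain ⟨v₀, hv₀, hmax⟩ := s.exists_max_image (fun v => φ v.1) hne
    have hne' : (s.filter fun v => φ v.1 = φ v₀.1).Nonempty := ⟨v₀, by simp [hv₀]⟩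
    exact ⟨_, hK.down s hsK _ (filter_subset _ _), hne',
      setOf_isMaxOn_slice hc' (hs2 s hsK) (filter_subset _ _) hne' hmax
        fun v hv => by simp [hv]⟩
  · rintro _ ⟨s, hsK, -, rfl⟩ _ ⟨t, htK, -, rfl⟩
    rw [hK.slice_inter hc' hsK htK (hs2 s hsK) (hs2 t htK)]
    rcases (s ∩ t).eq_empty_or_nonempty with h | h
    · exact Or.inl (by simp [h, slice])
    · obtain ⟨v, hv⟩ := h
      have hne : (slice (s ∩ t)).Nonempty := ⟨_, fst_mem_slice hv⟩
      obtain ⟨φ, hφ⟩ := hK.exists_face hsK hc' (hs2 s hsK) inter_subset_left ⟨v, hv⟩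
      obtain ⟨ψ, hψ⟩ := hK.exists_face htK hc' (hs2 t htK) inter_subset_right ⟨v, hv⟩
      exact Or.inr ⟨⟨hne, φ, hφ.symm⟩, ⟨hne, ψ, hψ.symm⟩⟩

end Lattice

end EdgewiseFan

theorem statement1 (d : ℕ) (hd : 0 < d) (P : Set (Fin d → ℝ)) (hP : IsIntegralPolytope P) :
    ∃ c : ℕ, 0 < c ∧
      ∃ T : Set (Set (Fin d → ℝ)), IsUnimodularTriangulation T ((c : ℝ) • P) := by
  classical
  obtain ⟨V, -, hV, rfl⟩ := hP
  obtain ⟨o, ho⟩ := EdgewiseFan.exists_linearOrder_isOrderedAddMonoid ((Fin d → ℝ) × ℝ)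
  have hlevel : EdgewiseFan.AtLevel (EdgewiseFan.heightLattice d) (LinearMap.snd ℝ _ ℝ) 1
      (V.image fun v => (v, (1 : ℝ))) := by
    intro w hw
    obtain ⟨v, hv, rfl⟩ := Finset.mem_image.1 hw
    exact ⟨⟨hV v hv, AddSubgroup.mem_zmultiples 1⟩, by simp⟩
  obtain ⟨K, c, hK, hfin, hcar, hc, hs, hind⟩ := @EdgewiseFan.exists_unimodular_fan
    ((Fin d → ℝ) × ℝ) _ _ o ho _ _ _ _ _ (EdgewiseFan.boxFinite_heightLattice d) _ _ hlevel
  have hP : (c : ℝ) • convexHull ℝ (V : Set (Fin d → ℝ))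
      = {x | (x, (c : ℝ)) ∈ EdgewiseFan.carrier K} := by
    ext x
    rw [hcar]
    exact (EdgewiseFan.mem_coneOf_iff_mem_smul V (by exact_mod_cast hc)).symm
  refine ⟨c, hc, _, hP ▸ EdgewiseFan.isTriangulation_slices hK hfin hc hs, ?_⟩
  rintro _ ⟨s, hsK, hne, rfl⟩
  exact ⟨EdgewiseFan.isIntegralSimplex_slice hK hsK hne (hs s hsK),
    EdgewiseFan.polyIndex_slice hK hc hsK hne (hs s hsK) (hind s hsK)⟩
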